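/- Let 0 < p < 1 and let f be a function in the Hardy space H^2 of the unit disk, with boundary values (nontangential limits) also denoted f on the unit circle T. Then f ∈ Q_p if and only if ||f||_{Q_p(T)}^2 := ∫_{-π}^{π} |f|^2 dσ + sup_{I⊂T} |I|^{-p} ∫_I ∫_I |f(ζ) - f(η)|^2 / |ζ - η|^{2-p} |dζ| |dη| < ∞, where the supremum is over all arcs I of T; moreover ||f||_{Q_p} is comparable to ||f||_{Q_p(T)}. -/

import Mathlib

open MeasureTheory Complex Metric Set Filter
open scoped ENNReal Real

noncomputable section

/-- The open unit disk in `ℂ`. -/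
def unitDisk : Set ℂ := Metric.ball 0 1

/-- The Möbius automorphism `φ_a(z) = (a - z)/(1 - ā z)` of the unit disk. -/
def moebius (a z : ℂ) : ℂ := (a - z) / (1 - (starRingEnd ℂ) a * z)

/-- Membership in `H^∞(𝔻)`: bounded analytic functions on the unit disk. -/
def MemHinf (f : ℂ → ℂ) : Prop :=
  DifferentiableOn ℂ f unitDisk ∧ ∃ M : ℝ, ∀ z ∈ unitDisk, ‖f z‖ ≤ M

/-- The integral `∫_𝔻 |f'(z)|² (1 - |φ_a(z)|²)^p dA(z)`. -/
def qpIntegral (p : ℝ) (f : ℂ → ℂ) (a : ℂ) : ℝ≥0∞ :=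
  ∫⁻ z in unitDisk, ENNReal.ofReal (‖deriv f z‖ ^ 2 * (1 - ‖moebius a z‖ ^ 2) ^ p)

/-- Finiteness of the `H²`-part of the `Q_p` norm: the integrals of `|f|²` over circles of
radius `r < 1` are uniformly bounded (equivalently, the boundary integral `∫ |f|² dσ`
is finite). -/
def h2Bounded (f : ℂ → ℂ) : Prop :=
  ∃ M : ℝ, ∀ r ∈ Set.Ico (0 : ℝ) 1,
    (∫ t in (0 : ℝ)..(2 * Real.pi), ‖f ((r : ℂ) * Complex.exp (Complex.I * t))‖ ^ 2) ≤ M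

/-- Membership in the space `Q_p`: `f` is analytic on the unit disk and
`‖f‖_{Q_p}² = ∫_𝕋 |f|² dσ + sup_{a ∈ 𝔻} ∫_𝔻 |f'(z)|² (1 - |φ_a(z)|²)^p dA(z) < ∞`. -/
def MemQp (p : ℝ) (f : ℂ → ℂ) : Prop :=
  DifferentiableOn ℂ f unitDisk ∧ h2Bounded f ∧
    ∃ C : ℝ, ∀ a ∈ unitDisk, qpIntegral p f a ≤ ENNReal.ofReal C

/-- The multiplier algebra `M(Q_p)`. -/
def MemMQp (p : ℝ) (φ : ℂ → ℂ) : Prop :=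
  MemQp p φ ∧ ∀ f : ℂ → ℂ, MemQp p f → MemQp p (fun z => φ z * f z)

/-- The Carleson square `S(I)` over the arc of the unit circle centered at `e^{iθ}` with
normalized length `h`. -/
def carlesonBox (θ h : ℝ) : Set ℂ :=
  {z : ℂ | 1 - h < ‖z‖ ∧ ‖z‖ < 1 ∧
    ∃ t : ℝ, |t - θ| < Real.pi * h ∧ z = (‖z‖ : ℂ) * Complex.exp (Complex.I * t)}

/-- A measure `μ` on the unit disk is a `p`-Carleson measure if `μ(S(I)) ≤ C |I|^p`
for every arc `I` of the unit circle. -/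
def IsPCarleson (p : ℝ) (μ : Measure ℂ) : Prop :=
  ∃ C : ℝ, ∀ θ : ℝ, ∀ h ∈ Set.Ioc (0 : ℝ) 1,
    μ (carlesonBox θ h) ≤ ENNReal.ofReal (C * h ^ p)

/-- The `p`-Carleson constant `‖μ‖_p = sup_{I ⊂ 𝕋} μ(S(I))/|I|^p`. -/
def pCarlesonNorm (p : ℝ) (μ : Measure ℂ) : ℝ≥0∞ :=
  ⨆ (θ : ℝ) (h : ℝ) (_ : h ∈ Set.Ioc (0 : ℝ) 1),
    μ (carlesonBox θ h) / ENNReal.ofReal (h ^ p)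

/-- The measure `w(z) dA(z)` on the unit disk. -/
def diskMeasure (w : ℂ → ℝ) : Measure ℂ :=
  (volume.restrict unitDisk).withDensity fun z => ENNReal.ofReal (w z)

/-- The Wirtinger derivative `∂F/∂z`. -/
def wderiv (F : ℂ → ℂ) (z : ℂ) : ℂ :=
  (fderiv ℝ F z 1 - Complex.I * fderiv ℝ F z Complex.I) / 2

/-- The Wirtinger derivative `∂F/∂z̄`. -/
def wderivBar (F : ℂ → ℂ) (z : ℂ) : ℂ :=
  (fderiv ℝ F z 1 + Complex.I * fderiv ℝ F z Complex.I) / 2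

/-- The squared length of the (real) gradient: `|∇F|² = 2|∂F/∂z|² + 2|∂F/∂z̄|²`. -/
def gradSq (F : ℂ → ℂ) (z : ℂ) : ℝ :=
  2 * ‖wderiv F z‖ ^ 2 + 2 * ‖wderivBar F z‖ ^ 2

/-- The arc of the unit circle centered at `e^{iθ}` of normalized length `h`, parametrized
by angle. -/
def arcInterval (θ h : ℝ) : Set ℝ := Set.Ioo (θ - Real.pi * h) (θ + Real.pi * h)

/-- The double integral `∫_I ∫_I |f(ξ) - f(η)|²/|ξ - η|^{2-p} |dξ| |dη|` over the arc
centered at `e^{iθ}` of normalized length `h`. -/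
def qpTDouble (p : ℝ) (f : ℝ → ℂ) (θ h : ℝ) : ℝ≥0∞ :=
  ∫⁻ s in arcInterval θ h, ∫⁻ u in arcInterval θ h,
    ENNReal.ofReal (‖f s - f u‖ ^ 2 /
      ‖Complex.exp (Complex.I * s) - Complex.exp (Complex.I * u)‖ ^ (2 - p))

/-- The integral `∫_𝕋 |f|² dσ` of a function on the unit circle (parametrized by angle). -/
def l2Circle (f : ℝ → ℂ) : ℝ≥0∞ :=
  ∫⁻ t in Set.Ioc (0 : ℝ) (2 * Real.pi), (‖f t‖₊ : ℝ≥0∞) ^ 2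

/-- Membership in `Q_p(𝕋)` for a function on the unit circle (parametrized by angle):
`f ∈ L²(𝕋)` and `sup_{I ⊂ 𝕋} |I|^{-p} ∫_I ∫_I |f(ξ) - f(η)|²/|ξ - η|^{2-p} |dξ||dη| < ∞`. -/
def MemQpT (p : ℝ) (f : ℝ → ℂ) : Prop :=
  Function.Periodic f (2 * Real.pi) ∧ Measurable f ∧ l2Circle f < ⊤ ∧
    ∃ C : ℝ, ∀ θ : ℝ, ∀ h ∈ Set.Ioc (0 : ℝ) 1, qpTDouble p f θ h ≤ ENNReal.ofReal (C * h ^ p)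

/-- The square of the `Q_p` norm of an analytic function `f` on the disk with boundary
values `fb`. -/
def qpNormSq (p : ℝ) (f : ℂ → ℂ) (fb : ℝ → ℂ) : ℝ≥0∞ :=
  l2Circle fb + ⨆ a ∈ unitDisk, qpIntegral p f a

/-- The square of the `Q_p(𝕋)` norm of a function on the unit circle. -/
def qpTNormSq (p : ℝ) (fb : ℝ → ℂ) : ℝ≥0∞ :=
  l2Circle fb + ⨆ (θ : ℝ) (h : ℝ) (_ : h ∈ Set.Ioc (0 : ℝ) 1),
    qpTDouble p fb θ h / ENNReal.ofReal (h ^ p)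

/-- `fb` is the a.e. radial boundary-value function of `F`. -/
def RadialLimit (F : ℂ → ℂ) (fb : ℝ → ℂ) : Prop :=
  ∀ᵐ t : ℝ, Filter.Tendsto (fun r : ℝ => F ((r : ℂ) * Complex.exp (Complex.I * t)))
    (nhdsWithin 1 (Set.Iio 1)) (nhds (fb t))

/-- The Poisson integral (harmonic extension) of a function on the unit circle. -/
def poissonExt (f : ℝ → ℂ) (z : ℂ) : ℂ :=
  (1 / (2 * Real.pi)) • ∫ t in (0 : ℝ)..(2 * Real.pi),
    ((1 - ‖z‖ ^ 2) / ‖Complex.exp (Complex.I * t) - z‖ ^ 2) • f t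




lemma lint_rpow_Ioc {a d : ℝ} (ha : -1 < a) (hd : 0 ≤ d) :
    ∫⁻ x in Ioc 0 d, ENNReal.ofReal (x ^ a) = ENNReal.ofReal (d ^ (a+1) / (a+1)) := by
  rw [← ofReal_integral_eq_lintegral_ofReal]
  · rw [← intervalIntegral.integral_of_le hd, integral_rpow (Or.inl ha),
      Real.zero_rpow (by linarith), sub_zero]
  · exact (intervalIntegrable_iff_integrableOn_Ioc_of_le hd).1
      (intervalIntegral.intervalIntegrable_rpow' ha)
  · refine (ae_restrict_iff' measurableSet_Ioc).2 (Eventually.of_forall fun x hx => ?_)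
    exact Real.rpow_nonneg hx.1.le _

lemma lint_rpow_Ioi {a d : ℝ} (ha : a < -1) (hd : 0 < d) :
    ∫⁻ x in Ioi d, ENNReal.ofReal (x ^ a) = ENNReal.ofReal (d ^ (a+1) / (-(a+1))) := by
  rw [← ofReal_integral_eq_lintegral_ofReal]
  · rw [integral_Ioi_rpow_of_lt ha hd, div_neg, neg_div]
  · exact integrableOn_Ioi_rpow_of_lt ha hd
  · refine (ae_restrict_iff' measurableSet_Ioi).2 (Eventually.of_forall fun x hx => ?_)
    exact Real.rpow_nonneg (hd.le.trans (le_of_lt hx)) _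

/-- radial kernel -/
def gk (p d : ℝ) (v : ℂ) : ℝ := ‖v‖ ^ (p-2) * ((max d ‖v‖) ^ 2)⁻¹

lemma lint_gk {p d : ℝ} (hp0 : 0 < p) (hp1 : p < 1) (hd : 0 < d) :
    ∫⁻ v, ENNReal.ofReal (gk p d v) ≤
      ENNReal.ofReal (2 * π * (1/p + 1/(2-p)) * d ^ (p-2)) := by
  rw [← Complex.lintegral_comp_polarCoord_symm]
  have h1 : ∀ q ∈ polarCoord.target, ENNReal.ofReal q.1 • ENNReal.ofReal (gk p d (Complex.polarCoord.symm q)) = (fun q : ℝ × ℝ => ENNReal.ofReal (q.1 ^ (p-1) * ((max d q.1)^2)⁻¹)) q := by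
    intro q hq
    have hq1 : 0 < q.1 := hq.1
    simp only [gk, norm_polarCoord_symm, abs_of_pos hq1, smul_eq_mul]
    rw [← ENNReal.ofReal_mul hq1.le, ← mul_assoc]
    congr 2
    rw [show p - 1 = 1 + (p-2) by ring, Real.rpow_add hq1, Real.rpow_one]
  rw [setLIntegral_congr_fun polarCoord.open_target.measurableSet h1, polarCoord_target,
    Measure.volume_eq_prod, setLIntegral_prod]
  swap
  · apply Measurable.aemeasurable; fun_prop
  simp only [lintegral_const, Measure.restrict_apply MeasurableSet.univ, univ_inter, Real.volume_Ioo]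
  rw [lintegral_mul_const _ (by fun_prop), ← Ioc_union_Ioi_eq_Ioi hd.le,
    lintegral_union measurableSet_Ioi (by
      rw [Set.disjoint_left]; intro x hx hx'; exact absurd hx.2 (not_le.2 hx'))]
  have e1 : ∫⁻ x in Ioc 0 d, ENNReal.ofReal (x ^ (p-1) * ((max d x)^2)⁻¹) = ENNReal.ofReal (d ^ (p-2) / p) := by
    have : ∀ x ∈ Ioc 0 d, ENNReal.ofReal (x ^ (p-1) * ((max d x)^2)⁻¹) = ENNReal.ofReal (x ^ (p-1)) * ENNReal.ofReal ((d^2)⁻¹) := by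
      intro x hx
      rw [max_eq_left hx.2, ENNReal.ofReal_mul (Real.rpow_nonneg hx.1.le _)]
    rw [setLIntegral_congr_fun measurableSet_Ioc this, lintegral_mul_const _ (by fun_prop),
      lint_rpow_Ioc (by linarith) hd.le, ← ENNReal.ofReal_mul (by simp only [sub_add_cancel]; positivity)]
    congr 1
    rw [Real.rpow_sub hd, Real.rpow_two]; simp only [sub_add_cancel]; field_simp
  have e2 : ∫⁻ x in Ioi d, ENNReal.ofReal (x ^ (p-1) * ((max d x)^2)⁻¹) = ENNReal.ofReal (d ^ (p-2) / (2-p)) := by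
    have : ∀ x ∈ Ioi d, ENNReal.ofReal (x ^ (p-1) * ((max d x)^2)⁻¹) = ENNReal.ofReal (x ^ (p-3)) := by
      intro x hx
      have hx0 : 0 < x := hd.trans hx
      rw [max_eq_right (le_of_lt hx), show p - 3 = (p-1) - 2 by ring, Real.rpow_sub hx0 (p-1) 2, Real.rpow_two, div_eq_mul_inv]
    rw [setLIntegral_congr_fun measurableSet_Ioi this, lint_rpow_Ioi (by linarith) hd]
    rw [show p - 3 + 1 = p - 2 by ring, neg_sub]
  rw [e1, e2, ← ENNReal.ofReal_add (by positivity) (div_nonneg (by positivity) (by linarith)), ← ENNReal.ofReal_mul (add_nonneg (by positivity) (div_nonneg (by positivity) (by linarith)))]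
  apply ENNReal.ofReal_le_ofReal
  apply le_of_eq; ring

lemma k0_pt {p : ℝ} (hp0 : 0 < p) (hp1 : p < 1) {ζ η w : ℂ} (hζ : ‖ζ‖ = 1) (hη : ‖η‖ = 1)
    (hw : ‖w‖ < 1) :
    (1-‖w‖^2)^p / (‖ζ-w‖^2*‖η-w‖^2) ≤ 2 * (gk p (‖ζ-η‖/2) (ζ-w) + gk p (‖ζ-η‖/2) (η-w)) := by
  wlog hle : ‖ζ-w‖ ≤ ‖η-w‖ generalizing ζ η
  · have := this hη hζ (le_of_not_ge hle)
    rw [norm_sub_rev η ζ, add_comm (gk _ _ (η - w))] at this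
    rwa [mul_comm (‖ζ-w‖^2)]
  have h0 : 0 ≤ gk p (‖ζ-η‖/2) (η-w) := by unfold gk; positivity
  suffices (1-‖w‖^2)^p / (‖ζ-w‖^2*‖η-w‖^2) ≤ 2 * gk p (‖ζ-η‖/2) (ζ-w) by linarith
  have hx : 1 - ‖w‖ ≤ ‖ζ - w‖ := by rw [← hζ]; exact norm_sub_norm_le ζ w
  have hx0 : 0 < ‖ζ - w‖ := by linarith
  have hm : max (‖ζ-η‖/2) ‖ζ-w‖ ≤ ‖η-w‖ := by
    apply max_le _ hle
    have : ‖ζ - η‖ ≤ ‖ζ-w‖ + ‖η-w‖ := by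
      rw [norm_sub_rev η w]; simpa using norm_add_le (ζ-w) (w-η)
    linarith
  have hm0 : 0 < max (‖ζ-η‖/2) ‖ζ-w‖ := lt_max_of_lt_right hx0
  unfold gk
  have h1 : (1-‖w‖^2)^p ≤ 2 * ‖ζ-w‖^p := by
    have hn := norm_nonneg w
    calc (1-‖w‖^2)^p ≤ (2*‖ζ-w‖)^p := by
          apply Real.rpow_le_rpow _ _ hp0.le <;> nlinarith
      _ = 2^p * ‖ζ-w‖^p := Real.mul_rpow (by norm_num) hx0.le
      _ ≤ _ := by
        gcongr
        calc (2:ℝ)^p ≤ 2^(1:ℝ) := Real.rpow_le_rpow_of_exponent_le (by norm_num) hp1.le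
          _ = 2 := by norm_num
  rw [Real.rpow_sub hx0, Real.rpow_two]
  calc (1-‖w‖^2)^p / (‖ζ-w‖^2*‖η-w‖^2) ≤ (2 * ‖ζ-w‖^p) / (‖ζ-w‖^2*(max (‖ζ-η‖/2) ‖ζ-w‖)^2) := by
        gcongr
    _ = _ := by field_simp

lemma k0_est {p : ℝ} (hp0 : 0 < p) (hp1 : p < 1) : ∃ C : ℝ, 0 < C ∧ ∀ ζ η : ℂ, ‖ζ‖ = 1 → ‖η‖ = 1 →
    ζ ≠ η → ∫⁻ w in unitDisk, ENNReal.ofReal ((1-‖w‖^2)^p / (‖ζ-w‖^2*‖η-w‖^2)) ≤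
      ENNReal.ofReal (C * ‖ζ-η‖^(p-2)) := by
  have h2p : 0 < 2 - p := by linarith
  refine ⟨4 * (2 * π * (1/p + 1/(2-p)) * (1/2) ^ (p-2)), by positivity, fun ζ η hζ hη hne => ?_⟩
  have hd : 0 < ‖ζ-η‖ := norm_pos_iff.2 (sub_ne_zero.2 hne)
  have hmeas : ∀ ξ : ℂ, Measurable fun w => ENNReal.ofReal (gk p (‖ζ-η‖/2) (ξ-w)) := by
    intro ξ; unfold gk; fun_prop
  have htr : ∀ ξ : ℂ, ∫⁻ w, ENNReal.ofReal (gk p (‖ζ-η‖/2) (ξ-w)) ≤ ENNReal.ofReal (2 * π * (1/p + 1/(2-p)) * (‖ζ-η‖/2) ^ (p-2)) := by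
    intro ξ
    rw [lintegral_sub_left_eq_self (fun w => ENNReal.ofReal (gk p (‖ζ-η‖/2) w))]
    exact lint_gk hp0 hp1 (by positivity)
  have hg : ∀ v, 0 ≤ gk p (‖ζ-η‖/2) v := by intro v; unfold gk; positivity
  calc _ ≤ ∫⁻ w in unitDisk, 2 * (ENNReal.ofReal (gk p (‖ζ-η‖/2) (ζ-w)) + ENNReal.ofReal (gk p (‖ζ-η‖/2) (η-w))) := by
        refine setLIntegral_mono' measurableSet_ball fun w hw => ?_
        have hw' : ‖w‖ < 1 := by simpa [unitDisk] using hw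
        rw [← ENNReal.ofReal_add (hg _) (hg _), show (2:ℝ≥0∞) = ENNReal.ofReal 2 by simp, ← ENNReal.ofReal_mul (by norm_num)]
        exact ENNReal.ofReal_le_ofReal (k0_pt hp0 hp1 hζ hη hw')
    _ ≤ ∫⁻ w, 2 * (ENNReal.ofReal (gk p (‖ζ-η‖/2) (ζ-w)) + ENNReal.ofReal (gk p (‖ζ-η‖/2) (η-w))) := setLIntegral_le_lintegral _ _
    _ = 2 * ((∫⁻ w, ENNReal.ofReal (gk p (‖ζ-η‖/2) (ζ-w))) + ∫⁻ w, ENNReal.ofReal (gk p (‖ζ-η‖/2) (η-w))) := by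
        rw [lintegral_const_mul' _ _ (by simp), lintegral_add_left (hmeas ζ)]
    _ ≤ 2 * (ENNReal.ofReal (2 * π * (1/p + 1/(2-p)) * (‖ζ-η‖/2) ^ (p-2)) + ENNReal.ofReal (2 * π * (1/p + 1/(2-p)) * (‖ζ-η‖/2) ^ (p-2))) := by
        gcongr <;> exact htr _
    _ = _ := by
        rw [← ENNReal.ofReal_add (by positivity) (by positivity), show (2:ℝ≥0∞) = ENNReal.ofReal 2 by simp, ← ENNReal.ofReal_mul (by norm_num)]
        congr 1
        rw [div_eq_mul_one_div ‖ζ-η‖ 2, Real.mul_rpow (by positivity) (by positivity)]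
        ring


lemma mob_den_ne {a z : ℂ} (ha : ‖a‖ < 1) (hz : ‖z‖ ≤ 1) : 1 - (starRingEnd ℂ) a * z ≠ 0 := by
  intro h
  have h1 : (starRingEnd ℂ) a * z = 1 := (sub_eq_zero.1 h).symm
  have h2 : ‖a‖ * ‖z‖ = 1 := by
    have := congrArg norm h1
    simpa using this
  nlinarith [norm_nonneg a, norm_nonneg z]

lemma mob_norm_id (a z : ℂ) :
    ‖1 - (starRingEnd ℂ) a * z‖^2 - ‖a - z‖^2 = (1 - ‖a‖^2) * (1 - ‖z‖^2) := by
  simp only [← Complex.normSq_eq_norm_sq, Complex.normSq_apply]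
  simp
  ring

lemma mob_one_sub {a z : ℂ} (ha : ‖a‖ < 1) (hz : ‖z‖ ≤ 1) :
    1 - ‖moebius a z‖^2 = (1 - ‖a‖^2) * (1 - ‖z‖^2) / ‖1 - (starRingEnd ℂ) a * z‖^2 := by
  have h := norm_ne_zero_iff.2 (mob_den_ne ha hz)
  rw [← mob_norm_id, moebius, norm_div, sub_div, div_self (pow_ne_zero 2 h), div_pow]

lemma conj_mul_eq (a : ℂ) : (starRingEnd ℂ) a * a = ((‖a‖^2 : ℝ) : ℂ) := by
  rw [mul_comm, Complex.mul_conj, Complex.normSq_eq_norm_sq]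

lemma one_sub_ne {a : ℂ} (ha : ‖a‖ < 1) : 1 - (starRingEnd ℂ) a * a ≠ 0 := mob_den_ne ha ha.le

lemma one_sub_norm {a : ℂ} (ha : ‖a‖ < 1) : ‖1 - (starRingEnd ℂ) a * a‖ = 1 - ‖a‖^2 := by
  rw [conj_mul_eq, ← Complex.ofReal_one, ← Complex.ofReal_sub, Complex.norm_real, Real.norm_eq_abs, abs_of_nonneg]
  nlinarith [norm_nonneg a]

lemma mob_one_sub_conj {a z : ℂ} (ha : ‖a‖ < 1) (hz : ‖z‖ ≤ 1) :
    1 - (starRingEnd ℂ) a * moebius a z = (1 - (starRingEnd ℂ) a * a) / (1 - (starRingEnd ℂ) a * z) := by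
  have h := mob_den_ne ha hz
  unfold moebius; field_simp; ring

lemma mob_mob {a z : ℂ} (ha : ‖a‖ < 1) (hz : ‖z‖ ≤ 1) : moebius a (moebius a z) = z := by
  have h := mob_den_ne ha hz
  have h2 := one_sub_ne ha
  conv_lhs => rw [moebius]
  rw [mob_one_sub_conj ha hz]
  unfold moebius
  have h' : 1 - z * (starRingEnd ℂ) a ≠ 0 := by rwa [mul_comm]
  have h3 : 1 - a * (starRingEnd ℂ) a ≠ 0 := by rwa [mul_comm]
  field_simp
  ring

lemma mob_sub {a z w : ℂ} (ha : ‖a‖ < 1) (hz : ‖z‖ ≤ 1) (hw : ‖w‖ ≤ 1) :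
    ‖moebius a z - moebius a w‖ = (1 - ‖a‖^2) * ‖z - w‖ /
      (‖1 - (starRingEnd ℂ) a * z‖ * ‖1 - (starRingEnd ℂ) a * w‖) := by
  have h := mob_den_ne ha hz
  have h' := mob_den_ne ha hw
  rw [← one_sub_norm ha, ← norm_mul, ← norm_mul, ← norm_div, ← norm_neg]
  congr 1
  have h'' : 1 - z * (starRingEnd ℂ) a ≠ 0 := by rwa [mul_comm]
  have h''' : 1 - w * (starRingEnd ℂ) a ≠ 0 := by rwa [mul_comm]
  unfold moebius; field_simp; ring

lemma mob_lt {a z : ℂ} (ha : ‖a‖ < 1) (hz : ‖z‖ < 1) : ‖moebius a z‖ < 1 := by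
  have h := mob_one_sub ha hz.le
  have hp : 0 < (1 - ‖a‖^2) * (1 - ‖z‖^2) / ‖1 - (starRingEnd ℂ) a * z‖^2 := by
    have := norm_pos_iff.2 (mob_den_ne ha hz.le)
    have h1 : 0 < 1 - ‖a‖^2 := by nlinarith [norm_nonneg a]
    have h2 : 0 < 1 - ‖z‖^2 := by nlinarith [norm_nonneg z]
    positivity
  rw [← h] at hp
  nlinarith [norm_nonneg (moebius a z)]

lemma mob_unit {a z : ℂ} (ha : ‖a‖ < 1) (hz : ‖z‖ = 1) : ‖moebius a z‖ = 1 := by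
  have h := mob_one_sub ha hz.le
  rw [hz] at h
  norm_num at h
  have h3 : ‖moebius a z‖^2 = 1 := by linarith
  nlinarith [norm_nonneg (moebius a z)]

lemma mem_unitDisk {z : ℂ} : z ∈ unitDisk ↔ ‖z‖ < 1 := by simp [unitDisk]

lemma mob_image {a : ℂ} (ha : ‖a‖ < 1) : moebius a '' unitDisk = unitDisk := by
  ext z
  constructor
  · rintro ⟨w, hw, rfl⟩
    exact mem_unitDisk.2 (mob_lt ha (mem_unitDisk.1 hw))
  · intro hz
    have := mem_unitDisk.1 hz
    exact ⟨moebius a z, mem_unitDisk.2 (mob_lt ha this), mob_mob ha this.le⟩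

lemma mob_hasDeriv {a z : ℂ} (ha : ‖a‖ < 1) (hz : ‖z‖ ≤ 1) :
    HasDerivAt (moebius a) (-(1 - (starRingEnd ℂ) a * a) / (1 - (starRingEnd ℂ) a * z)^2) z := by
  have h := mob_den_ne ha hz
  have h1 : HasDerivAt (fun z : ℂ => a - z) (-1) z := (hasDerivAt_id z).const_sub a
  have h2 : HasDerivAt (fun z : ℂ => 1 - (starRingEnd ℂ) a * z) (-((starRingEnd ℂ) a * 1)) z :=
    ((hasDerivAt_id z).const_mul _).const_sub 1
  have h3 := h1.div h2 h
  have e : (-1 * (1 - (starRingEnd ℂ) a * z) - (a - z) * -((starRingEnd ℂ) a * 1)) / (1 - (starRingEnd ℂ) a * z) ^ 2 = -(1 - (starRingEnd ℂ) a * a) / (1 - (starRingEnd ℂ) a * z)^2 := by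
    congr 1; ring
  rw [e] at h3
  exact h3

lemma det_cplx (c : ℂ) : ((ContinuousLinearMap.toSpanSingleton ℂ c).restrictScalars ℝ : ℂ →L[ℝ] ℂ).det = ‖c‖^2 := by
  simp [ContinuousLinearMap.det, LinearMap.det_restrictScalars,
      Algebra.norm_complex_eq, Complex.normSq_eq_norm_sq]

lemma ka_cov {p : ℝ} {a ζ η : ℂ} (ha : ‖a‖ < 1) (hζ : ‖ζ‖ = 1) (hη : ‖η‖ = 1) :
    ∫⁻ z in unitDisk, ENNReal.ofReal ((1-‖moebius a z‖^2)^p / (‖ζ-z‖^2*‖η-z‖^2)) =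
    ENNReal.ofReal (((1 - ‖a‖^2)/(‖1 - (starRingEnd ℂ) a * ζ‖ * ‖1 - (starRingEnd ℂ) a * η‖))^2) *
     ∫⁻ w in unitDisk, ENNReal.ofReal ((1-‖w‖^2)^p / (‖moebius a ζ-w‖^2*‖moebius a η-w‖^2)) := by
  have hcov := lintegral_image_eq_lintegral_abs_det_fderiv_mul volume
    (s := unitDisk) (f := moebius a)
    (f' := fun z => (ContinuousLinearMap.toSpanSingleton ℂ (-(1 - (starRingEnd ℂ) a * a) / (1 - (starRingEnd ℂ) a * z)^2)).restrictScalars ℝ)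
    measurableSet_ball
    (fun z hz => ((mob_hasDeriv ha (mem_unitDisk.1 hz).le).hasFDerivAt.restrictScalars ℝ).hasFDerivWithinAt)
    (fun z hz w hw h => by
      rw [← mob_mob ha (mem_unitDisk.1 hz).le, h, mob_mob ha (mem_unitDisk.1 hw).le])
    (fun z => ENNReal.ofReal ((1-‖moebius a z‖^2)^p / (‖ζ-z‖^2*‖η-z‖^2)))
  rw [mob_image ha] at hcov
  rw [hcov, ← lintegral_const_mul' _ _ ENNReal.ofReal_ne_top]
  refine setLIntegral_congr_fun measurableSet_ball fun w hw => ?_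
  have hw' := mem_unitDisk.1 hw
  have hn := fun ξ (hξ : ‖ξ‖ = 1) => mob_sub ha (mob_unit ha hξ).le hw'.le
  have hZ := norm_pos_iff.2 (mob_den_ne ha hζ.le)
  have hH := norm_pos_iff.2 (mob_den_ne ha hη.le)
  have hW := norm_pos_iff.2 (mob_den_ne ha hw'.le)
  have hA : 0 < 1 - ‖a‖^2 := by nlinarith [norm_nonneg a]
  have e : ∀ ξ, ‖ξ‖ = 1 → ‖ξ - moebius a w‖ = ‖moebius a ξ - w‖ * ‖1 - (starRingEnd ℂ) a * ξ‖ / ‖1 - (starRingEnd ℂ) a * w‖ := by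
    intro ξ hξ
    have h := hn ξ hξ
    have hX := norm_pos_iff.2 (mob_den_ne ha hξ.le)
    rw [mob_mob ha hξ.le, mob_one_sub_conj ha hξ.le, norm_div, one_sub_norm ha] at h
    rw [h]; field_simp
  simp only [det_cplx]
  rw [← ENNReal.ofReal_mul (abs_nonneg _), ← ENNReal.ofReal_mul (sq_nonneg _)]
  congr 1
  rw [e ζ hζ, e η hη, mob_mob ha hw'.le, norm_div, norm_neg, one_sub_norm ha, norm_pow,
    abs_of_nonneg (sq_nonneg _)]
  have h1 : 0 < ‖moebius a ζ - w‖ := by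
    have := norm_sub_norm_le (moebius a ζ) w
    rw [mob_unit ha hζ] at this; linarith
  have h2 : 0 < ‖moebius a η - w‖ := by
    have := norm_sub_norm_le (moebius a η) w
    rw [mob_unit ha hη] at this; linarith
  field_simp

lemma ka_est {p : ℝ} (hp0 : 0 < p) (hp1 : p < 1) : ∃ C : ℝ, 0 < C ∧ ∀ a ζ η : ℂ, ‖a‖ < 1 → ‖ζ‖ = 1 →
    ‖η‖ = 1 → ζ ≠ η →
    ∫⁻ z in unitDisk, ENNReal.ofReal ((1-‖moebius a z‖^2)^p / (‖ζ-z‖^2*‖η-z‖^2)) ≤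
      ENNReal.ofReal (C * ((1 - ‖a‖^2)/(‖1 - (starRingEnd ℂ) a * ζ‖ * ‖1 - (starRingEnd ℂ) a * η‖))^p
        / ‖ζ-η‖^(2-p)) := by
  obtain ⟨C, hC, h⟩ := k0_est hp0 hp1
  refine ⟨C, hC, fun a ζ η ha hζ hη hne => ?_⟩
  rw [ka_cov ha hζ hη]
  have hne' : moebius a ζ ≠ moebius a η := by
    intro h; apply hne; rw [← mob_mob ha hζ.le, h, mob_mob ha hη.le]
  refine (mul_le_mul_right (h _ _ (mob_unit ha hζ) (mob_unit ha hη) hne') _).trans ?_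
  rw [← ENNReal.ofReal_mul (sq_nonneg _)]
  apply ENNReal.ofReal_le_ofReal
  rw [mob_sub ha hζ.le hη.le]
  have hZ := norm_pos_iff.2 (mob_den_ne ha hζ.le)
  have hH := norm_pos_iff.2 (mob_den_ne ha hη.le)
  have hA : 0 < 1 - ‖a‖^2 := by nlinarith [norm_nonneg a]
  have hd : 0 < ‖ζ - η‖ := norm_pos_iff.2 (sub_ne_zero.2 hne)
  have hx : 0 < (1 - ‖a‖^2)/(‖1 - (starRingEnd ℂ) a * ζ‖ * ‖1 - (starRingEnd ℂ) a * η‖) := by positivity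
  rw [mul_div_right_comm, Real.mul_rpow hx.le hd.le, Real.rpow_sub hx, show p - 2 = -(2-p) by ring,
    Real.rpow_neg hd.le, Real.rpow_two]
  apply le_of_eq
  field_simp


lemma l1_of_l2 {α : Type*} [MeasurableSpace α] {μ : Measure α} [IsFiniteMeasure μ]
    {g : ℕ → α → ℝ≥0∞} (hg : ∀ n, Measurable (g n)) {K : ℝ≥0∞} (hK : K ≠ ⊤)
    (hb : ∀ n, ∫⁻ x, (g n x)^2 ∂μ ≤ K)
    (hlim : ∀ᵐ x ∂μ, Tendsto (fun n => g n x) atTop (nhds 0)) :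
    Tendsto (fun n => ∫⁻ x, g n x ∂μ) atTop (nhds 0) := by
  rw [ENNReal.tendsto_nhds_zero]
  intro ε hε
  have hε2 : 0 < ε/2 := ENNReal.half_pos hε.ne'
  obtain ⟨L, hL⟩ : ∃ L : ℕ, K / L < ε/2 ∧ 0 < L := by
    have h := ENNReal.Tendsto.const_div (a := K) ENNReal.tendsto_nat_nhds_top (Or.inr hK)
    rw [ENNReal.div_top] at h
    exact ((h.eventually_lt_const hε2).and (eventually_gt_atTop 0)).exists
  have hLne : (L : ℝ≥0∞) ≠ 0 := by exact_mod_cast hL.2.ne'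
  have hmin : Tendsto (fun n => ∫⁻ x, min (g n x) L ∂μ) atTop (nhds (∫⁻ x, 0 ∂μ)) := by
    refine tendsto_lintegral_of_dominated_convergence (fun _ => (L : ℝ≥0∞))
      (fun n => (hg n).min measurable_const) (fun n => Eventually.of_forall fun x => min_le_right _ _) ?_ ?_
    · rw [lintegral_const]; exact ENNReal.mul_ne_top (by simp) (measure_ne_top _ _)
    · filter_upwards [hlim] with x hx
      have := hx.min (tendsto_const_nhds (x := (L : ℝ≥0∞)))
      simpa using this
  rw [lintegral_zero, ENNReal.tendsto_nhds_zero] at hmin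
  filter_upwards [hmin (ε/2) hε2] with n hn
  have hpt : ∀ x, g n x ≤ min (g n x) L + (g n x)^2 * (L : ℝ≥0∞)⁻¹ := by
    intro x
    rcases le_total (g n x) L with h | h
    · rw [min_eq_left h]; exact le_self_add
    · refine le_add_left ?_
      calc g n x = g n x * (L * (L : ℝ≥0∞)⁻¹) := by rw [ENNReal.mul_inv_cancel hLne (by simp), mul_one]
        _ ≤ g n x * (g n x * (L : ℝ≥0∞)⁻¹) := by gcongr
        _ = _ := by ring
  calc ∫⁻ x, g n x ∂μ ≤ ∫⁻ x, (min (g n x) L + (g n x)^2 * (L : ℝ≥0∞)⁻¹) ∂μ := lintegral_mono hpt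
    _ = ∫⁻ x, min (g n x) L ∂μ + (∫⁻ x, (g n x)^2 ∂μ) * (L : ℝ≥0∞)⁻¹ := by
      rw [lintegral_add_left ((hg n).min measurable_const), lintegral_mul_const _ ((hg n).pow_const 2)]
    _ ≤ ε/2 + ε/2 := by
      gcongr
      exact (mul_le_mul_left (hb n) _).trans (le_of_lt hL.1)
    _ = ε := ENNReal.add_halves ε

/-- radii -/
def rad (n : ℕ) : ℝ := 1 - 1/((n:ℝ)+1)

lemma rad_nonneg (n : ℕ) : 0 ≤ rad n := by
  unfold rad; rw [sub_nonneg, div_le_one (by positivity)]; linarith [Nat.cast_nonneg (α := ℝ) n]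
lemma rad_lt (n : ℕ) : rad n < 1 := by
  unfold rad; have : 0 < 1/((n:ℝ)+1) := by positivity
  linarith
lemma rad_tendsto : Tendsto rad atTop (nhds 1) := by
  have := tendsto_one_div_add_atTop_nhds_zero_nat (𝕜 := ℝ)
  have h := (tendsto_const_nhds (x := (1:ℝ))).sub this
  rw [sub_zero] at h
  exact h
lemma rad_tendsto' : Tendsto rad atTop (nhdsWithin 1 (Iio 1)) :=
  tendsto_nhdsWithin_iff.2 ⟨rad_tendsto, Eventually.of_forall rad_lt⟩

lemma norm_ee (t : ℝ) : ‖Complex.exp (Complex.I * t)‖ = 1 := by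
  rw [mul_comm]; exact Complex.norm_exp_ofReal_mul_I t

lemma cont_ray {f : ℂ → ℂ} (hf : DifferentiableOn ℂ f unitDisk) {r : ℝ} (h0 : 0 ≤ r) (h1 : r < 1) :
    Continuous fun t : ℝ => f ((r : ℂ) * Complex.exp (Complex.I * t)) := by
  refine hf.continuousOn.comp_continuous (by fun_prop) fun t => ?_
  rw [mem_unitDisk, norm_mul, norm_ee, mul_one, Complex.norm_real, Real.norm_eq_abs, abs_of_nonneg h0]
  exact h1

lemma two_pi_pos' : (0:ℝ) ≤ 2 * π := by positivity

lemma l2_ray {f : ℂ → ℂ} (hf : DifferentiableOn ℂ f unitDisk) (h2 : h2Bounded f) :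
    ∃ K : ℝ≥0∞, K ≠ ⊤ ∧ ∀ n, ∫⁻ t in Ioc 0 (2*π), ‖f ((rad n : ℂ) * Complex.exp (Complex.I * t))‖ₑ^2 ≤ K := by
  obtain ⟨M, hM⟩ := h2
  refine ⟨ENNReal.ofReal M, ENNReal.ofReal_ne_top, fun n => ?_⟩
  have hc := cont_ray hf (rad_nonneg n) (rad_lt n)
  have h := hM (rad n) ⟨rad_nonneg n, rad_lt n⟩
  rw [intervalIntegral.integral_of_le two_pi_pos'] at h
  refine le_trans (le_of_eq ?_) (ENNReal.ofReal_le_ofReal h)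
  rw [ofReal_integral_eq_lintegral_ofReal]
  · congr 1; ext t
    rw [ENNReal.ofReal_pow (norm_nonneg _), ofReal_norm]
  · exact ((hc.norm.pow 2).integrableOn_Icc).mono_set Ioc_subset_Icc_self
  · exact Eventually.of_forall fun t => by positivity

lemma l2_fb {f : ℂ → ℂ} {fb : ℝ → ℂ} (hf : DifferentiableOn ℂ f unitDisk) (h2 : h2Bounded f)
    (hr : RadialLimit f fb) : l2Circle fb < ⊤ := by
  obtain ⟨K, hK, hb⟩ := l2_ray hf h2
  refine lt_of_le_of_lt ?_ hK.lt_top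
  have hc := fun n => cont_ray hf (rad_nonneg n) (rad_lt n)
  calc l2Circle fb = ∫⁻ t in Ioc 0 (2*π), liminf (fun n => ‖f ((rad n : ℂ) * Complex.exp (Complex.I * t))‖ₑ^2) atTop := by
        refine lintegral_congr_ae ?_
        filter_upwards [ae_restrict_of_ae hr] with t ht
        have h1 := (ht.comp rad_tendsto').enorm
        have h2 := ((ENNReal.continuous_pow 2).tendsto _).comp h1
        exact h2.liminf_eq.symm
    _ ≤ liminf (fun n => ∫⁻ t in Ioc 0 (2*π), ‖f ((rad n : ℂ) * Complex.exp (Complex.I * t))‖ₑ^2) atTop :=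
        lintegral_liminf_le fun n => ((hc n).enorm.measurable.pow_const 2)
    _ ≤ liminf (fun _ => K) atTop := liminf_le_liminf (Eventually.of_forall hb)
    _ = K := by simp

lemma l1_conv {f : ℂ → ℂ} {fb : ℝ → ℂ} (hf : DifferentiableOn ℂ f unitDisk) (h2 : h2Bounded f)
    (hm : Measurable fb) (hr : RadialLimit f fb) :
    Tendsto (fun n => ∫⁻ t in Ioc 0 (2*π), ‖f ((rad n : ℂ) * Complex.exp (Complex.I * t)) - fb t‖ₑ) atTop (nhds 0) := by
  obtain ⟨K, hK, hb⟩ := l2_ray hf h2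
  have hfb := l2_fb hf h2 hr
  have hc := fun n => cont_ray hf (rad_nonneg n) (rad_lt n)
  refine l1_of_l2 (K := 2 * K + 2 * l2Circle fb) (fun n => ((hc n).measurable.sub hm).enorm) ?_ ?_ ?_
  · exact ENNReal.add_ne_top.2 ⟨ENNReal.mul_ne_top (by simp) hK, ENNReal.mul_ne_top (by simp) hfb.ne⟩
  · intro n
    calc _ ≤ ∫⁻ t in Ioc 0 (2*π), (2 * ‖f ((rad n : ℂ) * Complex.exp (Complex.I * t))‖ₑ^2 + 2 * ‖fb t‖ₑ^2) := by
          refine lintegral_mono fun t => ?_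
          calc _ ≤ (‖f ((rad n : ℂ) * Complex.exp (Complex.I * t))‖ₑ + ‖fb t‖ₑ)^2 := by
                gcongr; exact enorm_sub_le
            _ ≤ _ := by
              rw [← mul_add]
              have := ENNReal.rpow_add_le_mul_rpow_add_rpow ‖f ((rad n : ℂ) * Complex.exp (Complex.I * t))‖ₑ ‖fb t‖ₑ (p := 2) (by norm_num)
              norm_num at this
              exact_mod_cast this
      _ = 2 * (∫⁻ t in Ioc 0 (2*π), ‖f ((rad n : ℂ) * Complex.exp (Complex.I * t))‖ₑ^2) + 2 * l2Circle fb := by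
          rw [lintegral_add_left (((hc n).enorm.measurable.pow_const 2).const_mul 2),
            lintegral_const_mul' _ _ (by simp), lintegral_const_mul' _ _ (by simp)]; rfl
      _ ≤ _ := by gcongr; exact hb n
  · filter_upwards [ae_restrict_of_ae hr] with t ht
    have h1 := ((ht.comp rad_tendsto').sub_const (fb t)).enorm
    simpa using h1

lemma ee_sub_ne {z : ℂ} (_hz : ‖z‖ < 1) (t : ℝ) : 1 - ‖z‖ ≤ ‖Complex.exp (Complex.I * t) - z‖ := by
  have := norm_sub_norm_le (Complex.exp (Complex.I * t)) z
  rwa [norm_ee] at this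

def cker (z : ℂ) (t : ℝ) : ℂ := Complex.exp (Complex.I * t) / (2 * π * (Complex.exp (Complex.I * t) - z)^2)

lemma ker_cont {z : ℂ} (hz : ‖z‖ < 1) : Continuous (cker z) := by
  unfold cker
  refine Continuous.div (by fun_prop) (by fun_prop) fun t => ?_
  have h := ee_sub_ne hz t
  have h2 : Complex.exp (Complex.I * t) - z ≠ 0 := norm_pos_iff.1 (by linarith)
  have : (π : ℂ) ≠ 0 := by exact_mod_cast Real.pi_ne_zero
  exact mul_ne_zero (mul_ne_zero two_ne_zero this) (pow_ne_zero 2 h2)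

lemma ker_norm {z : ℂ} (t : ℝ) : ‖cker z t‖ = 1 / (2*π * ‖Complex.exp (Complex.I * t) - z‖^2) := by
  unfold cker
  rw [norm_div, norm_ee, norm_mul, norm_pow, norm_mul, Complex.norm_real, Real.norm_eq_abs, abs_of_pos Real.pi_pos]
  simp

lemma cauchy_ray {f : ℂ → ℂ} (hf : DifferentiableOn ℂ f unitDisk) {z : ℂ} (hz : ‖z‖ < 1) {r : ℝ} (h0 : 0 ≤ r)
    (h1 : r < 1) (c : ℂ) : (r : ℂ) * deriv f (r * z) =
      ∫ t in Ioc 0 (2*π), (f ((r : ℂ) * Complex.exp (Complex.I * t)) - c) * cker z t := by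
  have hU : IsOpen {w : ℂ | ‖(r:ℂ) * w‖ < 1} := isOpen_lt (by fun_prop) continuous_const
  have hsub : closedBall (0:ℂ) 1 ⊆ {w : ℂ | ‖(r:ℂ) * w‖ < 1} := by
    intro w hw
    have hw' : ‖w‖ ≤ 1 := by simpa using hw
    simp only [mem_ofPred_eq, norm_mul, Complex.norm_real, Real.norm_eq_abs, abs_of_nonneg h0]
    nlinarith [norm_nonneg w]
  have hd : DifferentiableOn ℂ (fun w => f (r * w) - c) {w : ℂ | ‖(r:ℂ) * w‖ < 1} := by
    refine DifferentiableOn.sub_const (hf.comp (by fun_prop) fun w hw => mem_unitDisk.2 hw) c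
  have h := two_pi_I_inv_smul_circleIntegral_sub_sq_inv_smul_of_differentiable hU hsub hd
    (show z ∈ ball (0:ℂ) 1 by simpa using hz)
  have hrz : ‖(r:ℂ) * z‖ < 1 := by
    apply hsub; simpa using hz.le
  have hder : deriv (fun w => f (r * w) - c) z = (r : ℂ) * deriv f (r * z) := by
    have h1 : HasDerivAt f (deriv f (r*z)) (r*z) :=
      (hf.differentiableAt (isOpen_ball.mem_nhds (mem_unitDisk.2 hrz))).hasDerivAt
    have h2 : HasDerivAt (fun w : ℂ => (r:ℂ) * w) ((r:ℂ) * 1) z := (hasDerivAt_id z).const_mul _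
    have h3 := (h1.comp z h2).sub_const c
    rw [mul_one, mul_comm] at h3
    exact h3.deriv
  rw [← hder, ← h, circleIntegral, ← intervalIntegral.integral_smul, intervalIntegral.integral_of_le two_pi_pos']
  refine setIntegral_congr_fun measurableSet_Ioc fun t ht => ?_
  have hpi : (π : ℂ) ≠ 0 := by exact_mod_cast Real.pi_ne_zero
  have he := ee_sub_ne hz t
  have h2 : Complex.exp (Complex.I * t) - z ≠ 0 := norm_pos_iff.1 (by linarith)
  simp only [deriv_circleMap, circleMap, ofReal_one, one_mul, zero_add, smul_eq_mul, cker]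
  rw [mul_comm (t:ℂ) I]
  have := Complex.I_ne_zero
  field_simp

lemma deriv_repr {f : ℂ → ℂ} {fb : ℝ → ℂ} (hf : DifferentiableOn ℂ f unitDisk) (h2 : h2Bounded f)
    (hm : Measurable fb) (hr : RadialLimit f fb) {z : ℂ} (hz : ‖z‖ < 1) (c : ℂ) :
    deriv f z = ∫ t in Ioc 0 (2*π), (fb t - c) * cker z t := by
  have hc := fun n => cont_ray hf (rad_nonneg n) (rad_lt n)
  have hk := ker_cont hz
  obtain ⟨B, hB⟩ : ∃ B : ℝ, ∀ t, ‖cker z t‖ ≤ B := by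
    refine ⟨1 / (2*π*(1-‖z‖)^2), fun t => ?_⟩
    rw [ker_norm]
    have := ee_sub_ne hz t
    have h1 : 0 < 1 - ‖z‖ := by linarith
    gcongr
  have hlim1 : Tendsto (fun n => (rad n : ℂ) * deriv f (rad n * z)) atTop (nhds (deriv f z)) := by
    have hcont : ContinuousAt (fun w => deriv f w) z :=
      (hf.deriv isOpen_ball).continuousOn.continuousAt (isOpen_ball.mem_nhds (mem_unitDisk.2 hz))
    have hrad : Tendsto (fun n => (rad n : ℂ)) atTop (nhds 1) :=
      (Complex.continuous_ofReal.tendsto 1).comp rad_tendsto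
    have h1 : Tendsto (fun n => (rad n : ℂ) * z) atTop (nhds z) := by
      simpa using hrad.mul_const z
    simpa using hrad.mul (hcont.tendsto.comp h1)
  have hl1 := l1_conv hf h2 hm hr
  have hfin : IsFiniteMeasure (volume.restrict (Ioc (0:ℝ) (2*π))) := by infer_instance
  have hfbi : Integrable fb (volume.restrict (Ioc (0:ℝ) (2*π))) := by
    have : MemLp fb 2 (volume.restrict (Ioc (0:ℝ) (2*π))) := by
      refine ⟨hm.aestronglyMeasurable, ?_⟩
      rw [eLpNorm_lt_top_iff_lintegral_rpow_enorm_lt_top (by simp) (by simp)]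
      have := l2_fb hf h2 hr
      simpa [l2Circle, enorm_eq_nnnorm] using this
    exact this.integrable (by norm_num)
  have hlim2 := tendsto_integral_of_L1 (μ := volume.restrict (Ioc (0:ℝ) (2*π)))
    (fun t => (fb t - c) * cker z t)
    (F := fun n t => (f ((rad n : ℂ) * Complex.exp (Complex.I * t)) - c) * cker z t) (l := atTop)
    ((((hfbi.sub (integrable_const c)).mul_bdd (c := B) hk.aestronglyMeasurable
      (Eventually.of_forall hB))).aestronglyMeasurable)
    (Eventually.of_forall fun n =>
      ((((hc n).sub continuous_const).mul hk).integrableOn_Icc).mono_set Ioc_subset_Icc_self) ?_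
  · refine tendsto_nhds_unique hlim1 ?_
    convert hlim2 using 2 with n
    exact cauchy_ray hf hz (rad_nonneg n) (rad_lt n) c
  · have h3 : Tendsto (fun n => ENNReal.ofReal B * ∫⁻ t in Ioc 0 (2*π), ‖f ((rad n : ℂ) * Complex.exp (Complex.I * t)) - fb t‖ₑ) atTop (nhds 0) := by
      simpa using ENNReal.Tendsto.const_mul hl1 (Or.inr ENNReal.ofReal_ne_top)
    refine tendsto_of_tendsto_of_tendsto_of_le_of_le tendsto_const_nhds h3 (fun _ => zero_le) fun n => ?_
    simp only
    rw [← lintegral_const_mul' _ _ ENNReal.ofReal_ne_top]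
    refine lintegral_mono fun t => ?_
    rw [← sub_mul, sub_sub_sub_cancel_right, enorm_mul, mul_comm]
    gcongr
    rw [← ofReal_norm]; exact ENNReal.ofReal_le_ofReal (hB t)

lemma poisson_int {z : ℂ} (hz : ‖z‖ < 1) :
    ∫⁻ t in Ioc 0 (2*π), ENNReal.ofReal (1 / ‖Complex.exp (Complex.I * t) - z‖^2) =
      ENNReal.ofReal (2 * π / (1-‖z‖^2)) := by
  have h := (diffContOnCl_const (𝕜 := ℂ) (s := ball (0:ℂ) 1) (c := (1:ℂ))).circleAverage_poissonKernel_smul'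
    (show z ∈ ball (0:ℂ) 1 by simpa using hz)
  have hz1 : 0 < 1 - ‖z‖^2 := by nlinarith [norm_nonneg z]
  have hc : Continuous fun t : ℝ => 1 / ‖Complex.exp (Complex.I * t) - z‖^2 := by
    refine Continuous.div (by fun_prop) (by fun_prop) fun t => ?_
    have := ee_sub_ne hz t
    have : 0 < ‖Complex.exp (Complex.I * t) - z‖ := by linarith
    positivity
  rw [Real.circleAverage_def] at h
  have h2 : ∀ t : ℝ, ((‖circleMap 0 1 t - 0‖^2 - ‖z - 0‖^2) / ‖circleMap 0 1 t - 0 - (z - 0)‖^2) • (1:ℂ) =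
      (((1 - ‖z‖^2) * (1 / ‖Complex.exp (Complex.I * t) - z‖^2) : ℝ) : ℂ) := by
    intro t
    rw [Complex.real_smul, mul_one]
    congr 1
    simp only [circleMap, sub_zero, ofReal_one, one_mul, zero_add]
    rw [mul_comm (t:ℂ) I, norm_ee, one_pow]; ring
  simp_rw [h2] at h
  rw [intervalIntegral.integral_ofReal, Complex.real_smul, ← Complex.ofReal_mul, ← Complex.ofReal_one, Complex.ofReal_inj,
    intervalIntegral.integral_const_mul, intervalIntegral.integral_of_le two_pi_pos'] at h
  rw [← ofReal_integral_eq_lintegral_ofReal]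
  · congr 1
    have := Real.pi_pos
    field_simp at h ⊢
    linarith
  · exact (hc.integrableOn_Icc).mono_set Ioc_subset_Icc_self
  · exact Eventually.of_forall fun t => by positivity


lemma lint_cs {α : Type*} [MeasurableSpace α] {μ : Measure α} {φ ψ : α → ℝ≥0∞} (hφ : AEMeasurable φ μ)
    (hψ : AEMeasurable ψ μ) : (∫⁻ x, φ x * ψ x ∂μ)^2 ≤ (∫⁻ x, φ x^2 ∂μ) * ∫⁻ x, ψ x^2 ∂μ := by
  have h := ENNReal.lintegral_mul_le_Lp_mul_Lq μ (Real.HolderConjugate.two_two) hφ hψ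
  have h2 := pow_le_pow_left' h 2
  refine h2.trans (le_of_eq ?_)
  rw [mul_pow]
  simp only [← ENNReal.rpow_two, ← ENNReal.rpow_mul]
  norm_num

lemma ofReal_sq_norm (x : ℂ) : ENNReal.ofReal (‖x‖^2) = ‖x‖ₑ^2 := by
  rw [ENNReal.ofReal_pow (norm_nonneg _), ofReal_norm]

/-- squared inverse distance -/
def iv (z : ℂ) (t : ℝ) : ℝ≥0∞ := ENNReal.ofReal (1 / ‖Complex.exp (Complex.I * t) - z‖^2)

lemma iv_meas : Measurable (fun q : ℂ × ℝ => iv q.1 q.2) := by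
  unfold iv; fun_prop

lemma iv_meas1 (z : ℂ) : Measurable (iv z) := by
  unfold iv; fun_prop

lemma deriv_bd1 {f : ℂ → ℂ} {fb : ℝ → ℂ} (hf : DifferentiableOn ℂ f unitDisk) (h2 : h2Bounded f)
    (hm : Measurable fb) (hr : RadialLimit f fb) {z : ℂ} (hz : ‖z‖ < 1) (c : ℂ) :
    ‖deriv f z‖ₑ^2 ≤ ENNReal.ofReal (1/(2*π)) * (ENNReal.ofReal (1/(1-‖z‖^2))) *
      ∫⁻ t in Ioc 0 (2*π), ‖fb t - c‖ₑ^2 * iv z t := by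
  have hz1 : 0 < 1 - ‖z‖^2 := by nlinarith [norm_nonneg z]
  have h1 : ‖deriv f z‖ₑ ≤ ENNReal.ofReal (1/(2*π)) * ∫⁻ t in Ioc 0 (2*π), (‖fb t - c‖ₑ * ENNReal.ofReal (1 / ‖Complex.exp (Complex.I * t) - z‖)) * ENNReal.ofReal (1 / ‖Complex.exp (Complex.I * t) - z‖) := by
    rw [deriv_repr hf h2 hm hr hz c, ← lintegral_const_mul' _ _ ENNReal.ofReal_ne_top]
    refine (enorm_integral_le_lintegral_enorm _).trans (lintegral_mono fun t => le_of_eq ?_)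
    rw [enorm_mul, ← ofReal_norm (cker z t), ker_norm, mul_assoc (‖fb t - c‖ₑ), ← ENNReal.ofReal_mul (by positivity),
      mul_left_comm, ← ENNReal.ofReal_mul (by positivity)]
    congr 2
    field_simp
  have hm1 : Measurable fun t : ℝ => ENNReal.ofReal (1 / ‖Complex.exp (Complex.I * t) - z‖) := by fun_prop
  have hsq : ∀ t : ℝ, ENNReal.ofReal (1 / ‖Complex.exp (Complex.I * t) - z‖)^2 = iv z t := by
    intro t; rw [iv, ← ENNReal.ofReal_pow (by positivity)]; congr 1; rw [div_pow, one_pow]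
  refine (pow_le_pow_left' h1 2).trans ?_
  rw [mul_pow]
  refine (mul_le_mul_right (lint_cs (φ := fun t => ‖fb t - c‖ₑ * ENNReal.ofReal (1 / ‖Complex.exp (Complex.I * t) - z‖)) (ψ := fun t => ENNReal.ofReal (1 / ‖Complex.exp (Complex.I * t) - z‖)) (((hm.sub_const c).enorm.mul hm1).aemeasurable) hm1.aemeasurable) _).trans ?_
  simp_rw [mul_pow, hsq]
  have := poisson_int hz
  rw [show (∫⁻ t in Ioc 0 (2*π), iv z t) = ENNReal.ofReal (2 * π / (1-‖z‖^2)) from this]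
  rw [← ENNReal.ofReal_pow (by positivity), ← mul_assoc, mul_right_comm]
  refine mul_le_mul_left (le_of_eq ?_) _
  rw [← ENNReal.ofReal_mul (by positivity), ← ENNReal.ofReal_mul (by positivity)]
  congr 1
  field_simp

lemma deriv_bd2 {f : ℂ → ℂ} {fb : ℝ → ℂ} (hf : DifferentiableOn ℂ f unitDisk) (h2 : h2Bounded f)
    (hm : Measurable fb) (hr : RadialLimit f fb) {z : ℂ} (hz : ‖z‖ < 1) :
    ‖deriv f z‖ₑ^2 ≤ ENNReal.ofReal (1/(2*π)^2) *
      ∫⁻ u in Ioc 0 (2*π), ∫⁻ t in Ioc 0 (2*π), ‖fb t - fb u‖ₑ^2 * (iv z t * iv z u) := by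
  have hz1 : 0 < 1 - ‖z‖^2 := by nlinarith [norm_nonneg z]
  have hpi := Real.pi_pos
  have key : ‖deriv f z‖ₑ^2 * ENNReal.ofReal (2 * π / (1-‖z‖^2)) ≤
      ENNReal.ofReal (1/(2*π)) * (ENNReal.ofReal (1/(1-‖z‖^2))) *
       ∫⁻ u in Ioc 0 (2*π), ∫⁻ t in Ioc 0 (2*π), ‖fb t - fb u‖ₑ^2 * (iv z t * iv z u) := by
    rw [← poisson_int hz, ← lintegral_const_mul' _ _ (by simp),
      ← lintegral_const_mul' _ _ (ENNReal.mul_ne_top ENNReal.ofReal_ne_top ENNReal.ofReal_ne_top)]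
    refine lintegral_mono fun u => ?_
    refine (mul_le_mul_left (deriv_bd1 hf h2 hm hr hz (fb u)) _).trans (le_of_eq ?_)
    rw [mul_assoc _ (lintegral _ _) _, ← lintegral_mul_const' _ _ ENNReal.ofReal_ne_top]
    simp_rw [mul_assoc]; rfl
  have e : ‖deriv f z‖ₑ^2 = ENNReal.ofReal ((1-‖z‖^2)/(2*π)) * (‖deriv f z‖ₑ^2 * ENNReal.ofReal (2 * π / (1-‖z‖^2))) := by
    rw [mul_left_comm, ← ENNReal.ofReal_mul (by positivity)]
    rw [show (1 - ‖z‖ ^ 2) / (2 * π) * (2 * π / (1 - ‖z‖ ^ 2)) = 1 by field_simp]; simp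
  rw [e]
  refine (mul_le_mul_right key _).trans (le_of_eq ?_)
  rw [← mul_assoc, ← ENNReal.ofReal_mul (by positivity), ← ENNReal.ofReal_mul (by positivity)]
  congr 2
  field_simp

lemma ee_inj_ae (u : ℝ) : ∀ᵐ t : ℝ, Complex.exp (Complex.I * t) ≠ Complex.exp (Complex.I * u) := by
  have hc : Set.Countable {t : ℝ | Complex.exp (Complex.I * t) = Complex.exp (Complex.I * u)} := by
    refine (Set.countable_range (fun n : ℤ => u + n * (2*π))).mono ?_
    intro t ht
    obtain ⟨n, hn⟩ := Complex.exp_eq_exp_iff_exists_int.1 (show Complex.exp (Complex.I * t) = Complex.exp (Complex.I * u) from ht)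
    refine ⟨n, ?_⟩
    have h : Complex.I * (t:ℂ) = Complex.I * ((u + n * (2*π) : ℝ) : ℂ) := by
      rw [hn]; push_cast; ring
    have := mul_left_cancel₀ Complex.I_ne_zero h
    exact (Complex.ofReal_inj.1 this).symm
  exact hc.ae_notMem volume

/-- weight -/
def wt (a : ℂ) (t : ℝ) : ℝ := ‖1 - (starRingEnd ℂ) a * Complex.exp (Complex.I * t)‖

/-- the boundary integrand -/
def bint (p : ℝ) (fb : ℝ → ℂ) (s u : ℝ) : ℝ≥0∞ :=
  ENNReal.ofReal (‖fb s - fb u‖ ^ 2 /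
      ‖Complex.exp (Complex.I * s) - Complex.exp (Complex.I * u)‖ ^ (2 - p))

lemma mobw_meas (p : ℝ) (a : ℂ) : Measurable fun z => ENNReal.ofReal ((1 - ‖moebius a z‖^2)^p) := by
  have hmob : Measurable (moebius a) := by unfold moebius; fun_prop
  exact (((hmob.norm.pow_const 2).const_sub 1).pow_const p).ennreal_ofReal

lemma fdiff_meas {fb : ℝ → ℂ} (hm : Measurable fb) : Measurable fun q : ℝ × ℝ => ‖fb q.1 - fb q.2‖ₑ^2 := by
  have h1 : Measurable fun q : ℝ × ℝ => fb q.1 := hm.comp measurable_fst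
  have h2 : Measurable fun q : ℝ × ℝ => fb q.2 := hm.comp measurable_snd
  exact (h1.sub h2).enorm.pow_const 2

lemma qF_meas (p : ℝ) (a : ℂ) {fb : ℝ → ℂ} (hm : Measurable fb) : Measurable fun q : (ℂ × ℝ) × ℝ => ENNReal.ofReal ((1 - ‖moebius a q.1.1‖^2)^p) * (‖fb q.2 - fb q.1.2‖ₑ^2 * (iv q.1.1 q.2 * iv q.1.1 q.1.2)) := by
  have hp1 : Measurable fun q : (ℂ × ℝ) × ℝ => q.1.1 := measurable_fst.comp measurable_fst
  have hp2 : Measurable fun q : (ℂ × ℝ) × ℝ => q.1.2 := measurable_snd.comp measurable_fst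
  have hp3 : Measurable fun q : (ℂ × ℝ) × ℝ => q.2 := measurable_snd
  have k1 : Measurable fun q : (ℂ × ℝ) × ℝ => ENNReal.ofReal ((1 - ‖moebius a q.1.1‖^2)^p) :=
    Measurable.comp (g := fun z => ENNReal.ofReal ((1 - ‖moebius a z‖^2)^p)) (mobw_meas p a) hp1
  have k5 : Measurable fun q : (ℂ × ℝ) × ℝ => fb q.2 := hm.comp hp3
  have k6 : Measurable fun q : (ℂ × ℝ) × ℝ => fb q.1.2 := hm.comp hp2
  have k2 : Measurable fun q : (ℂ × ℝ) × ℝ => ‖fb q.2 - fb q.1.2‖ₑ^2 := (k5.sub k6).enorm.pow_const 2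
  have k3 : Measurable fun q : (ℂ × ℝ) × ℝ => iv q.1.1 q.2 := by unfold iv; fun_prop
  have k4 : Measurable fun q : (ℂ × ℝ) × ℝ => iv q.1.1 q.1.2 := by unfold iv; fun_prop
  exact k1.mul (k2.mul (k3.mul k4))

lemma qp_le_wt {p : ℝ} (hp0 : 0 < p) (hp1 : p < 1) : ∃ C : ℝ, 0 < C ∧ ∀ (f : ℂ → ℂ) (fb : ℝ → ℂ),
    DifferentiableOn ℂ f unitDisk → h2Bounded f → Measurable fb → RadialLimit f fb → ∀ a : ℂ, ‖a‖ < 1 →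
    qpIntegral p f a ≤ ENNReal.ofReal C * ∫⁻ u in Ioc 0 (2*π), ∫⁻ t in Ioc 0 (2*π),
      ENNReal.ofReal (((1 - ‖a‖^2) / (wt a t * wt a u))^p) * bint p fb t u := by
  obtain ⟨C, hC, hka⟩ := ka_est hp0 hp1
  refine ⟨1/(2*π)^2 * C, by positivity, fun f fb hf h2 hm hr a ha => ?_⟩
  have hF := qF_meas p a hm
  calc qpIntegral p f a ≤ ∫⁻ z in unitDisk, ENNReal.ofReal (1/(2*π)^2) * ∫⁻ u in Ioc 0 (2*π), ∫⁻ t in Ioc 0 (2*π),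
        ENNReal.ofReal ((1 - ‖moebius a z‖^2)^p) * (‖fb t - fb u‖ₑ^2 * (iv z t * iv z u)) := by
        refine setLIntegral_mono' measurableSet_ball fun z hz => ?_
        rw [ENNReal.ofReal_mul (sq_nonneg _), ofReal_sq_norm]
        refine (mul_le_mul_left (deriv_bd2 hf h2 hm hr (mem_unitDisk.1 hz)) _).trans (le_of_eq ?_)
        rw [mul_assoc]
        congr 1
        rw [mul_comm, ← lintegral_const_mul' _ _ ENNReal.ofReal_ne_top]
        congr 1; ext u
        rw [← lintegral_const_mul' _ _ ENNReal.ofReal_ne_top]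
    _ = ENNReal.ofReal (1/(2*π)^2) * ∫⁻ u in Ioc 0 (2*π), ∫⁻ t in Ioc 0 (2*π), ∫⁻ z in unitDisk,
        ENNReal.ofReal ((1 - ‖moebius a z‖^2)^p) * (‖fb t - fb u‖ₑ^2 * (iv z t * iv z u)) := by
        rw [lintegral_const_mul' _ _ ENNReal.ofReal_ne_top]
        congr 1
        rw [lintegral_lintegral_swap (hF.lintegral_prod_right'.aemeasurable)]
        congr 1; ext u
        rw [lintegral_lintegral_swap]
        exact (hF.comp (f := fun q : ℂ × ℝ => ((q.1, u), q.2)) ((measurable_fst.prodMk measurable_const).prodMk measurable_snd)).aemeasurable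
    _ ≤ ENNReal.ofReal (1/(2*π)^2) * ∫⁻ u in Ioc 0 (2*π), ∫⁻ t in Ioc 0 (2*π),
        ENNReal.ofReal C * (ENNReal.ofReal (((1 - ‖a‖^2) / (wt a t * wt a u))^p) * bint p fb t u) := by
        refine mul_le_mul_right (lintegral_mono fun u => ?_) _
        refine lintegral_mono_ae ?_
        filter_upwards [ae_restrict_of_ae (ee_inj_ae u)] with t ht
        have h := hka a _ _ ha (norm_ee t) (norm_ee u) ht
        calc _ = ‖fb t - fb u‖ₑ^2 * ∫⁻ z in unitDisk, ENNReal.ofReal ((1-‖moebius a z‖^2)^p / (‖Complex.exp (Complex.I * t)-z‖^2*‖Complex.exp (Complex.I * u)-z‖^2)) := by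
              rw [← lintegral_const_mul' _ _ (by simp)]
              refine setLIntegral_congr_fun measurableSet_ball fun z hz => ?_
              have hmp := mob_lt ha (mem_unitDisk.1 hz)
              have hmp' : 0 ≤ 1 - ‖moebius a z‖^2 := by nlinarith [norm_nonneg (moebius a z)]
              simp only [iv]
              rw [← ENNReal.ofReal_mul (by positivity), mul_left_comm, ← ENNReal.ofReal_mul (by positivity)]
              congr 2
              field_simp
          _ ≤ _ := (mul_le_mul_right h _)
          _ = _ := by
              rw [bint, ← ofReal_sq_norm, ← ENNReal.ofReal_mul (by positivity)]
              have hA : 0 < 1 - ‖a‖^2 := by nlinarith [norm_nonneg a]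
              have hw : 0 ≤ (1 - ‖a‖^2) / (wt a t * wt a u) := by unfold wt; positivity
              rw [← ENNReal.ofReal_mul (by positivity), ← ENNReal.ofReal_mul (by positivity)]
              congr 1
              unfold wt
              ring
    _ = _ := by
        simp_rw [lintegral_const_mul' _ _ (ENNReal.ofReal_ne_top (r := C))]
        rw [← mul_assoc, ← ENNReal.ofReal_mul (by positivity)]


lemma per_int {g : ℝ → ℝ≥0∞} (hg : Function.Periodic g (2*π)) (x y : ℝ) :
    ∫⁻ t in Ioc x (x + 2*π), g t = ∫⁻ t in Ioc y (y + 2*π), g t := by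
  have hpi : 0 < 2*π := by positivity
  refine (isAddFundamentalDomain_Ioc hpi x).setLIntegral_eq (isAddFundamentalDomain_Ioc hpi y) g ?_
  rintro ⟨v, hv⟩ t
  obtain ⟨n, rfl⟩ := hv
  have := hg.zsmul n t
  rw [add_comm] at this
  exact this

lemma per_int' {g : ℝ → ℝ≥0∞} (hg : Function.Periodic g (2*π)) (x θ : ℝ) :
    ∫⁻ t in Ioc x (x + 2*π), g t = ∫⁻ t in arcInterval θ 1, g t := by
  rw [per_int hg x (θ - π), arcInterval, restrict_Ioo_eq_restrict_Ioc]
  congr 3 <;> ring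

lemma ee_sub_eq (s u : ℝ) : ‖Complex.exp (Complex.I * s) - Complex.exp (Complex.I * u)‖ = 2 * |Real.sin ((s-u)/2)| := by
  have : Complex.exp (Complex.I * s) - Complex.exp (Complex.I * u) = Complex.exp (Complex.I * u) * (Complex.exp (Complex.I * ((s - u : ℝ))) - 1) := by
    rw [mul_sub, ← Complex.exp_add, mul_one]; push_cast; ring_nf
  rw [this, norm_mul, norm_ee, one_mul, Complex.norm_exp_I_mul_ofReal_sub_one]
  simp

lemma ee_sub_le (s u : ℝ) : ‖Complex.exp (Complex.I * s) - Complex.exp (Complex.I * u)‖ ≤ |s - u| := by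
  rw [ee_sub_eq]
  have := Real.abs_sin_le_abs (x := (s-u)/2)
  rw [abs_div, abs_two] at this
  linarith

lemma ee_sub_ge {s u : ℝ} (h : |s - u| ≤ π) : 2/π * |s - u| ≤ ‖Complex.exp (Complex.I * s) - Complex.exp (Complex.I * u)‖ := by
  rw [ee_sub_eq]
  have := Real.mul_abs_le_abs_sin (x := (s-u)/2) (by rw [abs_div, abs_two]; linarith)
  rw [abs_div, abs_two] at this
  linarith

/-- oscillation double integral -/
def EE (fb : ℝ → ℂ) (J K : Set ℝ) : ℝ≥0∞ := ∫⁻ s in J, ∫⁻ u in K, ‖fb s - fb u‖ₑ^2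

lemma EE_mono (fb : ℝ → ℂ) {J J' K K' : Set ℝ} (hJ : J ⊆ J') (hK : K ⊆ K') : EE fb J K ≤ EE fb J' K' :=
  (lintegral_mono_set hJ).trans (lintegral_mono fun _ => lintegral_mono_set hK)

lemma EE_symm {fb : ℝ → ℂ} (hm : Measurable fb) (J K : Set ℝ) : EE fb J K = EE fb K J := by
  unfold EE
  rw [lintegral_lintegral_swap (fdiff_meas hm).aemeasurable]
  congr 1; ext u; congr 1; ext s; rw [enorm_sub_rev]

lemma tri_sq (x y : ℂ) : ‖x + y‖ₑ^2 ≤ ENNReal.ofReal (3/2) * ‖x‖ₑ^2 + ENNReal.ofReal 3 * ‖y‖ₑ^2 := by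
  simp only [← ofReal_sq_norm]
  rw [← ENNReal.ofReal_mul (by positivity), ← ENNReal.ofReal_mul (by positivity), ← ENNReal.ofReal_add (by positivity) (by positivity)]
  refine ENNReal.ofReal_le_ofReal ?_
  have := norm_add_le x y
  have h2 : ‖x+y‖^2 ≤ (‖x‖+‖y‖)^2 := pow_le_pow_left₀ (norm_nonneg _) this 2
  nlinarith [sq_nonneg (‖x‖ - 2*‖y‖)]

lemma fd_meas1 {fb : ℝ → ℂ} (hm : Measurable fb) (c : ℂ) : Measurable fun u => ‖c - fb u‖ₑ^2 :=
  (hm.const_sub c).enorm.pow_const 2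

lemma EE_tri {fb : ℝ → ℂ} (hm : Measurable fb) (J K V : Set ℝ) :
    volume V * EE fb J K ≤ ENNReal.ofReal (3/2) * volume K * EE fb J V + ENNReal.ofReal 3 * volume J * EE fb V K := by
  have h1 : ∀ s u, volume V * ‖fb s - fb u‖ₑ^2 ≤ ENNReal.ofReal (3/2) * (∫⁻ v in V, ‖fb s - fb v‖ₑ^2) + ENNReal.ofReal 3 * ∫⁻ v in V, ‖fb u - fb v‖ₑ^2 := by
    intro s u
    rw [← lintegral_const_mul' _ _ ENNReal.ofReal_ne_top, ← lintegral_const_mul' _ _ ENNReal.ofReal_ne_top,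
      ← lintegral_add_left ((fd_meas1 hm _).const_mul _), mul_comm, ← setLIntegral_const]
    refine lintegral_mono fun v => ?_
    have := tri_sq (fb s - fb v) (fb v - fb u)
    rw [sub_add_sub_cancel, enorm_sub_rev (fb v)] at this
    exact this
  have hi : ∀ W : Set ℝ, Measurable fun s => ∫⁻ u in W, ‖fb s - fb u‖ₑ^2 := fun W => (fdiff_meas hm).lintegral_prod_right'
  have h2 : ∀ s, volume V * (∫⁻ u in K, ‖fb s - fb u‖ₑ^2) ≤ ENNReal.ofReal (3/2) * volume K * (∫⁻ v in V, ‖fb s - fb v‖ₑ^2) + ENNReal.ofReal 3 * EE fb K V := by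
    intro s
    rw [← lintegral_const_mul _ (fd_meas1 hm _)]
    refine (lintegral_mono fun u => h1 s u).trans (le_of_eq ?_)
    rw [lintegral_add_left measurable_const, setLIntegral_const, lintegral_const_mul' _ _ ENNReal.ofReal_ne_top, EE]
    ring
  unfold EE at *
  rw [← lintegral_const_mul _ (hi K)]
  refine (lintegral_mono fun s => h2 s).trans (le_of_eq ?_)
  rw [lintegral_add_left ((hi V).const_mul _), setLIntegral_const, lintegral_const_mul _ (hi V)]
  have := EE_symm hm K V
  unfold EE at this
  rw [this]
  ring

lemma bint_ge {p : ℝ} (hp1 : p < 1) (fb : ℝ → ℂ) {s u R : ℝ} (hR : |s - u| ≤ R) (hne : Complex.exp (Complex.I * s) ≠ Complex.exp (Complex.I * u)) :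
    ‖fb s - fb u‖ₑ^2 ≤ ENNReal.ofReal (R^(2-p)) * bint p fb s u := by
  have h0 : 0 < ‖Complex.exp (Complex.I * s) - Complex.exp (Complex.I * u)‖ := norm_pos_iff.2 (sub_ne_zero.2 hne)
  have hR0 : 0 ≤ R := (abs_nonneg _).trans hR
  rw [bint, ← ENNReal.ofReal_mul (by positivity), ← ofReal_sq_norm]
  refine ENNReal.ofReal_le_ofReal ?_
  have h1 : ‖Complex.exp (Complex.I * s) - Complex.exp (Complex.I * u)‖^(2-p) ≤ R^(2-p) :=
    Real.rpow_le_rpow h0.le ((ee_sub_le s u).trans hR) (by linarith)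
  have h2 : 0 < ‖Complex.exp (Complex.I * s) - Complex.exp (Complex.I * u)‖^(2-p) := Real.rpow_pos_of_pos h0 _
  rw [mul_div_assoc', le_div_iff₀ h2, mul_comm]
  exact mul_le_mul_of_nonneg_right h1 (sq_nonneg _)

lemma EE_diag {p : ℝ} (hp1 : p < 1) (fb : ℝ → ℂ) {θ h : ℝ} (_hh : 0 ≤ h) :
    EE fb (arcInterval θ h) (arcInterval θ h) ≤ ENNReal.ofReal ((2*π*h)^(2-p)) * qpTDouble p fb θ h := by
  unfold EE qpTDouble
  rw [← lintegral_const_mul' _ _ ENNReal.ofReal_ne_top]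
  refine setLIntegral_mono' measurableSet_Ioo fun s hs => ?_
  rw [← lintegral_const_mul' _ _ ENNReal.ofReal_ne_top]
  refine setLIntegral_mono_ae' measurableSet_Ioo ?_
  filter_upwards [ee_inj_ae s] with u hu hu2
  have h1 : |s - u| ≤ 2*π*h := by
    rw [abs_le]; constructor <;> linarith [hs.1, hs.2, hu2.1, hu2.2]
  exact bint_ge hp1 fb h1 hu.symm


/-- dyadic radius -/
def rho (h : ℝ) (k : ℕ) : ℝ := min 1 (2^k * h)

lemma rho_pos {h : ℝ} (hh : 0 < h) (k : ℕ) : 0 < rho h k := lt_min one_pos (by positivity)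
lemma rho_le_one (h : ℝ) (k : ℕ) : rho h k ≤ 1 := min_le_left _ _
lemma rho_le (h : ℝ) (k : ℕ) : rho h k ≤ 2^k * h := min_le_right _ _
lemma rho_mono {h : ℝ} (hh : 0 < h) : Monotone (rho h) := by
  intro j k hjk
  refine min_le_min le_rfl (mul_le_mul_of_nonneg_right ?_ hh.le)
  exact pow_le_pow_right₀ (by norm_num) hjk
lemma rho_succ {h : ℝ} (k : ℕ) : rho h (k+1) ≤ 2 * rho h k := by
  unfold rho
  rcases le_total 1 (2^k*h) with h1 | h1
  · rw [min_eq_left h1]; exact (min_le_left _ _).trans (by norm_num)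
  · rw [min_eq_right h1]; refine (min_le_right _ _).trans (le_of_eq ?_); ring

lemma arc_mono {θ h h' : ℝ} (hh : h ≤ h') : arcInterval θ h ⊆ arcInterval θ h' := by
  have := mul_le_mul_of_nonneg_left hh Real.pi_pos.le
  exact Ioo_subset_Ioo (by linarith) (by linarith)

lemma arc_vol (θ h : ℝ) : volume (arcInterval θ h) = ENNReal.ofReal (2*π*h) := by
  rw [arcInterval, Real.volume_Ioo]; congr 1; ring

lemma EE_diag' {p : ℝ} (hp0 : 0 < p) (hp1 : p < 1) {fb : ℝ → ℂ} {θ m h : ℝ} (hm0 : 0 ≤ m)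
    (hM : ∀ h ∈ Ioc (0:ℝ) 1, qpTDouble p fb θ h ≤ ENNReal.ofReal (m * h^p)) (hh : h ∈ Ioc (0:ℝ) 1) :
    EE fb (arcInterval θ h) (arcInterval θ h) ≤ ENNReal.ofReal (40 * m * h^2) := by
  refine (EE_diag hp1 fb hh.1.le).trans ((mul_le_mul_right (hM h hh) _).trans ?_)
  have h0 := hh.1
  rw [← ENNReal.ofReal_mul (by positivity)]
  refine ENNReal.ofReal_le_ofReal ?_
  rw [Real.mul_rpow (by positivity) h0.le]
  have e : h^(2-p) * h^p = h^2 := by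
    rw [← Real.rpow_add h0]; norm_num
  have e2 : (2*π)^(2-p) ≤ 40 := by
    have h1 : (2*π)^(2-p) ≤ (2*π)^(2:ℝ) := Real.rpow_le_rpow_of_exponent_le (by linarith [Real.pi_gt_three]) (by linarith)
    rw [Real.rpow_two] at h1
    nlinarith [Real.pi_lt_d2, Real.pi_pos]
  calc (2*π)^(2-p) * h^(2-p) * (m * h^p) = (2*π)^(2-p) * m * (h^(2-p)*h^p) := by ring
    _ ≤ 40 * m * h^2 := by rw [e]; gcongr

lemma EE_bd {p : ℝ} (hp0 : 0 < p) (hp1 : p < 1) {fb : ℝ → ℂ} (hm : Measurable fb) {θ m h : ℝ} (hm0 : 0 ≤ m)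
    (hM : ∀ h ∈ Ioc (0:ℝ) 1, qpTDouble p fb θ h ≤ ENNReal.ofReal (m * h^p)) (hh : 0 < h) (j n : ℕ) :
    EE fb (arcInterval θ (rho h j)) (arcInterval θ (rho h (j+n))) ≤
      ENNReal.ofReal (2000 * (7/4)^n * m * rho h j * rho h (j+n)) := by
  induction n with
  | zero =>
    refine (EE_diag' hp0 hp1 hm0 hM ⟨rho_pos hh j, rho_le_one _ _⟩).trans (ENNReal.ofReal_le_ofReal ?_)
    have := rho_pos hh j
    simp only [pow_zero, add_zero]
    have : 0 ≤ m * (rho h j)^2 := by positivity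
    nlinarith
  | succ n ih =>
    set k := j + n with hk
    rw [← add_assoc, ← hk]
    have r1 := rho_pos hh j
    have r2 := rho_pos hh k
    have r3 := rho_pos hh (k+1)
    have hE : EE fb (arcInterval θ (rho h k)) (arcInterval θ (rho h (k+1))) ≤ ENNReal.ofReal (80 * m * rho h k * rho h (k+1)) := by
      refine (EE_mono fb (arc_mono (rho_mono hh (Nat.le_succ k))) le_rfl).trans ((EE_diag' hp0 hp1 hm0 hM ⟨r3, rho_le_one _ _⟩).trans (ENNReal.ofReal_le_ofReal ?_))
      have := rho_succ (h := h) k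
      have : m * (rho h (k+1) * rho h (k+1)) ≤ m * (2 * rho h k * rho h (k+1)) := by gcongr
      nlinarith
    have ht := EE_tri hm (arcInterval θ (rho h j)) (arcInterval θ (rho h (k+1))) (arcInterval θ (rho h k))
    simp only [arc_vol] at ht
    have hpi := Real.pi_pos
    have h0 : ENNReal.ofReal (2*π*rho h k) ≠ 0 := by
      rw [Ne, ENNReal.ofReal_eq_zero, not_le]; positivity
    refine (ENNReal.mul_le_mul_iff_right h0 ENNReal.ofReal_ne_top).1 ?_
    refine ht.trans ((add_le_add (mul_le_mul_right ih _) (mul_le_mul_right hE _)).trans ?_)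
    rw [← ENNReal.ofReal_mul (by positivity), ← ENNReal.ofReal_mul (by positivity), ← ENNReal.ofReal_mul (by positivity), ← ENNReal.ofReal_mul (by positivity), ← ENNReal.ofReal_add (by positivity) (by positivity), ← ENNReal.ofReal_mul (by positivity)]
    refine ENNReal.ofReal_le_ofReal ?_
    have h74 : (1:ℝ) ≤ (7/4)^n := one_le_pow₀ (by norm_num)
    have hX : 0 ≤ 2*π * rho h k * m * rho h j * rho h (k+1) := by positivity
    calc _ = (2*π * rho h k * m * rho h j * rho h (k+1)) * (3000 * (7/4)^n + 240) := by ring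
      _ ≤ (2*π * rho h k * m * rho h j * rho h (k+1)) * (3500 * (7/4)^n) := by
          gcongr; linarith
      _ = _ := by rw [pow_succ]; ring

/-- dyadic annuli -/
def ann (θ h : ℝ) : ℕ → Set ℝ
  | 0 => arcInterval θ (rho h 0)
  | (k+1) => arcInterval θ (rho h (k+1)) \ arcInterval θ (rho h k)

lemma ann_sub (θ h : ℝ) (k : ℕ) : ann θ h k ⊆ arcInterval θ (rho h k) := by
  cases k with
  | zero => exact le_rfl
  | succ k => exact sdiff_subset

lemma ann_meas (θ h : ℝ) (k : ℕ) : MeasurableSet (ann θ h k) := by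
  cases k with
  | zero => exact measurableSet_Ioo
  | succ k => exact measurableSet_Ioo.diff measurableSet_Ioo

lemma ann_cover {h : ℝ} (hh : 0 < h) (θ : ℝ) : arcInterval θ 1 ⊆ ⋃ k, ann θ h k := by
  intro s hs
  have hex : ∃ k, s ∈ arcInterval θ (rho h k) := by
    obtain ⟨k, hk⟩ := pow_unbounded_of_one_lt (1/h) (by norm_num : (1:ℝ) < 2)
    refine ⟨k, ?_⟩
    have : rho h k = 1 := by
      rw [rho, min_eq_left]; rw [div_lt_iff₀ hh] at hk; exact hk.le
    rwa [this]
  classical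
  rw [mem_iUnion]
  refine ⟨Nat.find hex, ?_⟩
  have h1 := Nat.find_spec hex
  rcases hn : Nat.find hex with _ | k
  · rw [hn] at h1; exact h1
  · rw [hn] at h1
    exact ⟨h1, Nat.find_min hex (by omega)⟩

lemma mem_arc {θ h s : ℝ} : s ∈ arcInterval θ h ↔ |s - θ| < π * h := by
  rw [arcInterval, mem_Ioo, abs_lt]; constructor <;> rintro ⟨h1, h2⟩ <;> constructor <;> linarith

lemma ann_succ {θ h s : ℝ} {k : ℕ} (hs : s ∈ ann θ h (k+1)) : π * (2^k * h) ≤ |s - θ| ∧ |s - θ| ≤ π := by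
  have h1 := mem_arc.1 hs.1
  have h2 : ¬ (|s - θ| < π * rho h k) := fun h' => hs.2 (mem_arc.2 h')
  push Not at h2
  have hp := Real.pi_pos
  have h3 : rho h k < 1 := lt_of_lt_of_le (lt_of_mul_lt_mul_left (h2.trans_lt h1) hp.le) (rho_le_one _ _)
  have h4 : rho h k = 2^k * h := by
    unfold rho at *
    rcases min_choice 1 (2^k*h) with h' | h' <;> [linarith; exact h']
  refine ⟨by rw [← h4]; exact h2, h1.le.trans ?_⟩
  have := rho_le_one h (k+1)
  nlinarith

lemma ann_chord {θ h s : ℝ} {k : ℕ} (hs : s ∈ ann θ h (k+1)) : 2^(k+1) * h ≤ ‖Complex.exp (Complex.I * s) - Complex.exp (Complex.I * θ)‖ := by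
  obtain ⟨h1, h2⟩ := ann_succ hs
  have h3 := ee_sub_ge h2
  have hp := Real.pi_pos
  have h4 : 2/π * (π * (2^k*h)) ≤ 2/π * |s - θ| := by gcongr
  refine le_trans (le_of_eq ?_) (h4.trans h3)
  field_simp; ring

lemma wt_eq (a : ℂ) (t : ℝ) : wt a t = ‖Complex.exp (Complex.I * t) - a‖ := by
  unfold wt
  have h : Complex.exp (Complex.I * t) * (starRingEnd ℂ) (Complex.exp (Complex.I * t)) = 1 := by
    rw [Complex.mul_conj, Complex.normSq_eq_norm_sq, norm_ee]; simp
  rw [← RCLike.norm_conj (1 - (starRingEnd ℂ) a * Complex.exp (Complex.I * t))]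
  rw [← one_mul ‖(starRingEnd ℂ) _‖, ← norm_ee t, ← norm_mul]
  congr 1
  rw [map_sub, map_mul, mul_sub, map_one, Complex.conj_conj, mul_one, mul_left_comm, h, mul_one]

lemma wt_ann {θ r s : ℝ} (h0 : 0 ≤ r) (h1 : r < 1) {k : ℕ} (hs : s ∈ ann θ (1-r) k) :
    2^k * (1-r) / 2 ≤ wt ((r:ℂ) * Complex.exp (Complex.I * θ)) s := by
  set a := (r:ℂ) * Complex.exp (Complex.I * θ) with ha
  have hna : ‖a‖ = r := by rw [ha, norm_mul, norm_ee, mul_one, Complex.norm_real, Real.norm_of_nonneg h0]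
  have hw := ee_sub_ne (by rw [hna]; exact h1) s (z := a)
  rw [hna, ← wt_eq] at hw
  cases k with
  | zero => rw [pow_zero, one_mul]; linarith
  | succ k =>
    have h2 := ann_chord hs
    have h3 : ‖Complex.exp (Complex.I * s) - Complex.exp (Complex.I * θ)‖ ≤ wt a s + (1 - r) := by
      rw [wt_eq]
      have e : Complex.exp (Complex.I * s) - Complex.exp (Complex.I * θ) = (Complex.exp (Complex.I * s) - a) - ((1-r : ℝ):ℂ) * Complex.exp (Complex.I * θ) := by
        rw [ha]; push_cast; ring
      rw [e]
      refine (norm_sub_le _ _).trans ?_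
      rw [norm_mul, norm_ee, Complex.norm_real, Real.norm_of_nonneg (by linarith), mul_one]
    linarith

lemma ann_chord2 {θ h s u : ℝ} (hh : 0 < h) {j n : ℕ} (hs : s ∈ ann θ h j) (hu : u ∈ ann θ h (j+(n+2))) :
    2^(j+(n+2)) * h / 5 ≤ ‖Complex.exp (Complex.I * s) - Complex.exp (Complex.I * u)‖ := by
  have h1 := ann_chord (k := j+n+1) hu
  have h2 := ee_sub_le s θ
  have h3 := mem_arc.1 (ann_sub _ _ _ hs)
  have h4 := rho_le h j
  have h5 : (2:ℝ)^j ≤ 2^(j+n) := pow_le_pow_right₀ (by norm_num) (by omega)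
  have hp := Real.pi_lt_d2
  have h6 : π * rho h j ≤ 3.15 * (2^(j+n) * h) := by
    have : rho h j ≤ 2^(j+n)*h := h4.trans (by gcongr)
    have := rho_pos hh j
    nlinarith
  have h7 : ‖Complex.exp (Complex.I * u) - Complex.exp (Complex.I * θ)‖ ≤ ‖Complex.exp (Complex.I * s) - Complex.exp (Complex.I * u)‖ + ‖Complex.exp (Complex.I * s) - Complex.exp (Complex.I * θ)‖ := by
    rw [norm_sub_rev (Complex.exp (Complex.I * s)) (Complex.exp (Complex.I * u))]
    exact norm_sub_le_norm_sub_add_norm_sub _ _ _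
  have e1 : (2:ℝ)^(j+n+1+1) = 4 * 2^(j+n) := by rw [pow_succ, pow_succ]; ring
  have e2 : (2:ℝ)^(j+(n+2)) = 4 * 2^(j+n) := by rw [← add_assoc, pow_add]; ring
  rw [e1] at h1
  rw [e2]
  have : 0 < (2:ℝ)^(j+n) * h := by positivity
  linarith


/-- weighted boundary integrand -/
def WW (p : ℝ) (fb : ℝ → ℂ) (a : ℂ) (s u : ℝ) : ℝ≥0∞ :=
  ENNReal.ofReal (((1 - ‖a‖^2) / (wt a s * wt a u))^p) * bint p fb s u

lemma bint_symm (p : ℝ) (fb : ℝ → ℂ) (s u : ℝ) : bint p fb s u = bint p fb u s := by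
  unfold bint; rw [norm_sub_rev, norm_sub_rev (Complex.exp _)]

lemma WW_symm (p : ℝ) (fb : ℝ → ℂ) (a : ℂ) (s u : ℝ) : WW p fb a s u = WW p fb a u s := by
  unfold WW; rw [bint_symm, mul_comm (wt a s)]

lemma bint_meas (p : ℝ) {fb : ℝ → ℂ} (hm : Measurable fb) : Measurable fun q : ℝ × ℝ => bint p fb q.1 q.2 := by
  unfold bint
  have h1 : Measurable fun q : ℝ × ℝ => fb q.1 := hm.comp measurable_fst
  have h2 : Measurable fun q : ℝ × ℝ => fb q.2 := hm.comp measurable_snd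
  have h3 : Measurable fun q : ℝ × ℝ => ‖fb q.1 - fb q.2‖^2 := (h1.sub h2).norm.pow_const 2
  have h4 : Measurable fun q : ℝ × ℝ => ‖Complex.exp (Complex.I * q.1) - Complex.exp (Complex.I * q.2)‖ ^ (2 - p) := by fun_prop
  exact (h3.div h4).ennreal_ofReal

lemma WW_meas (p : ℝ) {fb : ℝ → ℂ} (hm : Measurable fb) (a : ℂ) : Measurable fun q : ℝ × ℝ => WW p fb a q.1 q.2 := by
  unfold WW
  have h1 : Measurable fun q : ℝ × ℝ => ENNReal.ofReal (((1 - ‖a‖^2) / (wt a q.1 * wt a q.2))^p) := by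
    unfold wt; fun_prop
  exact h1.mul (bint_meas p hm)

lemma weight_bd {p : ℝ} (hp0 : 0 < p) {θ r : ℝ} (h0 : 0 ≤ r) (h1 : r < 1) {j k : ℕ} {s u : ℝ}
    (hs : s ∈ ann θ (1-r) j) (hu : u ∈ ann θ (1-r) k) :
    ((1 - ‖(r:ℂ) * Complex.exp (Complex.I * θ)‖^2) / (wt ((r:ℂ) * Complex.exp (Complex.I * θ)) s * wt ((r:ℂ) * Complex.exp (Complex.I * θ)) u))^p
     ≤ (8 / (2^j * (2^k * (1-r))))^p := by
  have w1 := wt_ann h0 h1 hs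
  have w2 := wt_ann h0 h1 hu
  set a := (r:ℂ) * Complex.exp (Complex.I * θ) with ha
  have hna : ‖a‖ = r := by rw [ha, norm_mul, norm_ee, mul_one, Complex.norm_real, Real.norm_of_nonneg h0]
  have hh : 0 < 1 - r := by linarith
  have hj : (0:ℝ) < 2^j := by positivity
  have hk : (0:ℝ) < 2^k := by positivity
  rw [hna]
  have e : 0 ≤ 1 - r^2 := by nlinarith
  have b : 0 < 2^j*(1-r)/2 * (2^k * (1-r)/2) := by positivity
  have hb : 2^j*(1-r)/2 * (2^k * (1-r)/2) ≤ wt a s * wt a u := mul_le_mul w1 w2 (by positivity) (le_trans (by positivity) w1)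
  refine Real.rpow_le_rpow (div_nonneg e (b.le.trans hb)) ?_ hp0.le
  calc (1-r^2)/(wt a s * wt a u) ≤ (2*(1-r)) / (2^j*(1-r)/2 * (2^k * (1-r)/2)) := by
        gcongr
        nlinarith
    _ = _ := by field_simp; norm_num

lemma term_bd {p : ℝ} (hp0 : 0 < p) (hp1 : p < 1) {fb : ℝ → ℂ} (hm : Measurable fb) {θ m r : ℝ} (hm0 : 0 ≤ m)
    (h0 : 0 ≤ r) (h1 : r < 1)
    (hM : ∀ h ∈ Ioc (0:ℝ) 1, qpTDouble p fb θ h ≤ ENNReal.ofReal (m * h^p)) (j n : ℕ) :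
    ∫⁻ s in ann θ (1-r) j, ∫⁻ u in ann θ (1-r) (j+n), WW p fb ((r:ℂ) * Complex.exp (Complex.I * θ)) s u
      ≤ ENNReal.ofReal (400000 * m * ((2^j)^(-p) * (7/8)^n)) := by
  set h := 1 - r with hhd
  have hh : 0 < h := by rw [hhd]; linarith
  set k := j + n with hk
  set R := 2^k * h with hR
  have hR0 : 0 < R := by positivity
  have hj : (0:ℝ) < 2^j := by positivity
  have h8 : (8:ℝ)^p ≤ 8 := by
    have := Real.rpow_le_rpow_of_exponent_le (x := 8) (by norm_num) hp1.le
    rwa [Real.rpow_one] at this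
  have ew : (8 / (2^j * R))^p = 8^p * (2^j)^(-p) * R^(-p) := by
    rw [Real.div_rpow (by norm_num) (by positivity), Real.mul_rpow hj.le hR0.le, Real.rpow_neg hj.le, Real.rpow_neg hR0.le]
    field_simp
  have hq : 0 < ((2:ℝ)^j)^(-p) := Real.rpow_pos_of_pos hj _
  rcases n with _ | _ | n
  rotate_left 2
  · have hb : ∀ s ∈ ann θ h j, ∀ u ∈ ann θ h k, WW p fb ((r:ℂ) * Complex.exp (Complex.I * θ)) s u ≤
        ENNReal.ofReal (200 * (2^j)^(-p) / R^2) * ‖fb s - fb u‖ₑ^2 := by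
      intro s hs u hu
      have hw := weight_bd hp0 h0 h1 hs hu
      have hc := ann_chord2 hh hs hu
      rw [WW, bint, ← ofReal_sq_norm, ← ENNReal.ofReal_mul' (by positivity), ← ENNReal.ofReal_mul (by positivity)]
      refine ENNReal.ofReal_le_ofReal ?_
      rw [← hhd, ← hR, ew] at hw
      rw [← hk, ← hR] at hc
      have hc2 : (R/5)^(2-p) ≤ ‖Complex.exp (Complex.I * s) - Complex.exp (Complex.I * u)‖ ^ (2 - p) :=
        Real.rpow_le_rpow (by positivity) hc (by linarith)
      have hc3 : 0 < (R/5)^(2-p) := by positivity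
      have h5 : (5:ℝ)^(2-p) ≤ 25 := by
        have := Real.rpow_le_rpow_of_exponent_le (x := 5) (by norm_num) (by linarith : 2 - p ≤ 2)
        rw [Real.rpow_two] at this; linarith
      have e3 : R^(-p) / (R/5)^(2-p) = 5^(2-p) / R^2 := by
        rw [Real.div_rpow hR0.le (by norm_num), ← Real.rpow_two, show (2:ℝ) = (2-p) + p by ring, Real.rpow_add hR0, Real.rpow_neg hR0.le, show 2 - p + p - p = 2 - p by ring]
        field_simp
      calc _ ≤ (8^p * (2^j)^(-p) * R^(-p)) * (‖fb s - fb u‖^2 / (R/5)^(2-p)) := by gcongr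
        _ = 8^p * (2^j)^(-p) * (R^(-p) / (R/5)^(2-p)) * ‖fb s - fb u‖^2 := by ring
        _ = 8^p * (2^j)^(-p) * (5^(2-p) / R^2) * ‖fb s - fb u‖^2 := by rw [e3]
        _ ≤ 8 * (2^j)^(-p) * (25 / R^2) * ‖fb s - fb u‖^2 := by gcongr
        _ = _ := by ring
    calc _ ≤ ∫⁻ s in ann θ h j, ∫⁻ u in ann θ h k, ENNReal.ofReal (200 * (2^j)^(-p) / R^2) * ‖fb s - fb u‖ₑ^2 :=
          setLIntegral_mono' (ann_meas _ _ _) fun s hs => setLIntegral_mono' (ann_meas _ _ _) fun u hu => hb s hs u hu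
      _ = ENNReal.ofReal (200 * (2^j)^(-p) / R^2) * EE fb (ann θ h j) (ann θ h k) := by
          simp_rw [lintegral_const_mul' _ _ ENNReal.ofReal_ne_top]; rfl
      _ ≤ _ := by
          refine (mul_le_mul_right ((EE_mono fb (ann_sub _ _ _) (ann_sub _ _ _)).trans (EE_bd hp0 hp1 hm hm0 hM hh j (n+2))) _).trans ?_
          rw [← ENNReal.ofReal_mul (by positivity)]
          refine ENNReal.ofReal_le_ofReal ?_
          have a1 := rho_le h j
          have a2 := rho_le h k
          have a3 := rho_pos hh j
          have a4 := rho_pos hh k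
          rw [← hR] at a2
          have e4 : 2^j * h / R = 1/2^(n+2) := by
            rw [hR, hk, pow_add]; field_simp
          calc 200 * (2^j)^(-p) / R^2 * (2000 * (7/4)^(n+2) * m * rho h j * rho h k)
              ≤ 200 * (2^j)^(-p) / R^2 * (2000 * (7/4)^(n+2) * m * (2^j*h) * R) := by gcongr
            _ = 400000 * m * (2^j)^(-p) * (7/4)^(n+2) * (2^j*h/R) := by field_simp; ring
            _ = 400000 * m * ((2^j)^(-p) * ((7/4)^(n+2) * (1/2^(n+2)))) := by rw [e4]; ring
            _ = _ := by
                rw [mul_one_div, ← div_pow]; norm_num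
  all_goals
    have hb : ∀ s ∈ ann θ h j, ∀ u ∈ ann θ h k, WW p fb ((r:ℂ) * Complex.exp (Complex.I * θ)) s u ≤
        ENNReal.ofReal (8 * (2^j)^(-p) * R^(-p)) * bint p fb s u := by
      intro s hs u hu
      have hw := weight_bd hp0 h0 h1 hs hu
      rw [← hhd, ← hR, ew] at hw
      refine mul_le_mul_left (ENNReal.ofReal_le_ofReal (hw.trans ?_)) _
      gcongr
    have hlt : (∫⁻ s in ann θ h j, ∫⁻ u in ann θ h k, WW p fb ((r:ℂ) * Complex.exp (Complex.I * θ)) s u) ≤ ENNReal.ofReal (8 * m * (2^j)^(-p)) := by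
      calc _ ≤ ∫⁻ s in ann θ h j, ∫⁻ u in ann θ h k, ENNReal.ofReal (8 * (2^j)^(-p) * R^(-p)) * bint p fb s u :=
            setLIntegral_mono' (ann_meas _ _ _) fun s hs => setLIntegral_mono' (ann_meas _ _ _) fun u hu => hb s hs u hu
        _ = ENNReal.ofReal (8 * (2^j)^(-p) * R^(-p)) * ∫⁻ s in ann θ h j, ∫⁻ u in ann θ h k, bint p fb s u := by
            simp_rw [lintegral_const_mul' _ _ ENNReal.ofReal_ne_top]
        _ ≤ ENNReal.ofReal (8 * (2^j)^(-p) * R^(-p)) * qpTDouble p fb θ (rho h k) := by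
            refine mul_le_mul_right ?_ _
            refine (lintegral_mono_set ((ann_sub _ _ _).trans (arc_mono (rho_mono hh (by omega : j ≤ k))))).trans ?_
            exact lintegral_mono fun _ => lintegral_mono_set (ann_sub _ _ _)
        _ ≤ ENNReal.ofReal (8 * (2^j)^(-p) * R^(-p)) * ENNReal.ofReal (m * R^p) := by
            refine mul_le_mul_right ((hM _ ⟨rho_pos hh k, rho_le_one _ _⟩).trans (ENNReal.ofReal_le_ofReal ?_)) _
            refine mul_le_mul_of_nonneg_left (Real.rpow_le_rpow (rho_pos hh k).le (rho_le h k) hp0.le) hm0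
        _ = _ := by
            rw [← ENNReal.ofReal_mul (by positivity)]; congr 1
            rw [Real.rpow_neg hR0.le]
            have : R^p ≠ 0 := by positivity
            field_simp
    refine hlt.trans (ENNReal.ofReal_le_ofReal ?_)
    have : 0 ≤ m * (2^j)^(-p) := by positivity
    norm_num
    nlinarith

lemma term_bd2 {p : ℝ} (hp0 : 0 < p) (hp1 : p < 1) : ∃ τ : ℝ, 0 ≤ τ ∧ τ < 1 ∧ ∀ {fb : ℝ → ℂ} (_ : Measurable fb) {θ m r : ℝ} (_ : 0 ≤ m)
    (_ : 0 ≤ r) (_ : r < 1)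
    (_ : ∀ h ∈ Ioc (0:ℝ) 1, qpTDouble p fb θ h ≤ ENNReal.ofReal (m * h^p)) (j k : ℕ),
    ∫⁻ s in ann θ (1-r) j, ∫⁻ u in ann θ (1-r) k, WW p fb ((r:ℂ) * Complex.exp (Complex.I * θ)) s u
      ≤ ENNReal.ofReal (400000 * m * (τ^j * τ^k)) := by
  set q := (2:ℝ)^(-p) with hq
  have hq0 : 0 < q := by positivity
  have hq1 : q < 1 := Real.rpow_lt_one_of_one_lt_of_neg (by norm_num) (by linarith)
  set σ := max q (7/8) with hσ
  have hσ0 : 0 < σ := lt_max_of_lt_left hq0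
  have hσ1 : σ < 1 := max_lt hq1 (by norm_num)
  have hτ1 : √σ < 1 := by rw [Real.sqrt_lt' one_pos]; simpa using hσ1
  have hτ0 : 0 < √σ := Real.sqrt_pos.2 hσ0
  have key : ∀ j n : ℕ, ((2:ℝ)^j)^(-p) * (7/8)^n ≤ √σ^j * √σ^(j+n) := by
    intro j n
    have e : ((2:ℝ)^j)^(-p) = q^j := by
      rw [hq, ← Real.rpow_natCast, ← Real.rpow_natCast, ← Real.rpow_mul (by norm_num), ← Real.rpow_mul (by norm_num), mul_comm]
    rw [e]
    have h1 : q^j ≤ σ^j := pow_le_pow_left₀ hq0.le (le_max_left _ _) j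
    have h2 : (7/8:ℝ)^n ≤ √σ^n := by
      refine pow_le_pow_left₀ (by norm_num) ?_ n
      refine (le_max_right q (7/8)).trans ?_
      rw [← hσ]
      nlinarith [Real.sq_sqrt hσ0.le]
    calc q^j * (7/8)^n ≤ σ^j * √σ^n := by gcongr
      _ = _ := by rw [pow_add, ← mul_assoc, ← mul_pow, Real.mul_self_sqrt hσ0.le]
  refine ⟨√σ, hτ0.le, hτ1, fun {fb} hm {θ m r} hm0 h0 h1 hM j k => ?_⟩
  rcases le_total j k with hjk | hjk
  · obtain ⟨n, rfl⟩ := Nat.exists_eq_add_of_le hjk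
    refine (term_bd hp0 hp1 hm hm0 h0 h1 hM j n).trans (ENNReal.ofReal_le_ofReal ?_)
    exact mul_le_mul_of_nonneg_left (key j n) (by positivity)
  · obtain ⟨n, rfl⟩ := Nat.exists_eq_add_of_le hjk
    rw [lintegral_lintegral_swap (WW_meas p hm _).aemeasurable]
    have := (term_bd hp0 hp1 hm hm0 h0 h1 hM k n).trans (ENNReal.ofReal_le_ofReal (mul_le_mul_of_nonneg_left (key k n) (by positivity)))
    rw [mul_comm (√σ ^ k)] at this
    refine le_trans (le_of_eq ?_) this
    congr 1; ext s; congr 1; ext u; rw [WW_symm]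

lemma dirA {p : ℝ} (hp0 : 0 < p) (hp1 : p < 1) : ∃ C : ℝ, 0 < C ∧ ∀ (f : ℂ → ℂ) (fb : ℝ → ℂ),
    DifferentiableOn ℂ f unitDisk → h2Bounded f → Measurable fb → Function.Periodic fb (2*π) → RadialLimit f fb →
    ∀ m : ℝ, 0 ≤ m → (∀ θ, ∀ h ∈ Ioc (0:ℝ) 1, qpTDouble p fb θ h ≤ ENNReal.ofReal (m * h^p)) → ∀ a ∈ unitDisk,
    qpIntegral p f a ≤ ENNReal.ofReal (C * m) := by
  obtain ⟨C1, hC1, hA⟩ := qp_le_wt hp0 hp1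
  obtain ⟨τ, ht0, ht1, hT⟩ := term_bd2 hp0 hp1
  have ht2 : 0 < 1 - τ := by linarith
  refine ⟨C1 * (400000 / (1-τ)^2), by positivity, fun f fb hf h2 hm hper hr m hm0 hM a ha => ?_⟩
  have ha1 := mem_unitDisk.1 ha
  refine (hA f fb hf h2 hm hr a ha1).trans ?_
  rw [mul_assoc, ENNReal.ofReal_mul hC1.le]
  refine mul_le_mul_right ?_ _
  set θ := Complex.arg a with hθ
  have hexp : Function.Periodic (fun t : ℝ => Complex.exp (Complex.I * t)) (2*π) := by
    intro t
    have : Complex.I * ((t + 2*π : ℝ):ℂ) = Complex.I * t + 2*π*Complex.I := by push_cast; ring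
    simp only [this, Complex.exp_periodic _]
  have hWper : ∀ s, Function.Periodic (fun t => WW p fb a t s) (2*π) := by
    intro s t
    have e := hexp t
    have e2 := hper t
    simp only at e
    simp only [WW, wt, bint, e, e2]
  have e1 : ∀ u, ∫⁻ t in Ioc 0 (2*π), WW p fb a t u = ∫⁻ t in arcInterval θ 1, WW p fb a t u := by
    intro u
    have := per_int' (hWper u) 0 θ
    rwa [zero_add] at this
  have e2 : (∫⁻ u in Ioc 0 (2*π), ∫⁻ t in arcInterval θ 1, WW p fb a t u) = ∫⁻ u in arcInterval θ 1, ∫⁻ t in arcInterval θ 1, WW p fb a t u := by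
    have := per_int' (g := fun u => ∫⁻ t in arcInterval θ 1, WW p fb a t u) (by
      intro u
      simp only [WW_symm p fb a _ (u + 2*π), (hWper _) u]
      simp only [WW_symm p fb a _ u]) 0 θ
    rwa [zero_add] at this
  have e3 : (∫⁻ u in Ioc 0 (2*π), ∫⁻ t in Ioc 0 (2*π), WW p fb a t u) = ∫⁻ u in arcInterval θ 1, ∫⁻ t in arcInterval θ 1, WW p fb a u t := by
    simp_rw [e1]; rw [e2]
    congr 1; ext u; congr 1; ext t; rw [WW_symm]
  refine le_of_eq_of_le e3 ?_
  set r := ‖a‖ with hr'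
  have har : a = (r:ℂ) * Complex.exp (Complex.I * θ) := by
    rw [mul_comm Complex.I]; exact (Complex.norm_mul_exp_arg_mul_I a).symm
  have hh : 0 < 1 - r := by linarith
  have hcov := ann_cover hh θ
  calc _ ≤ ∫⁻ u in ⋃ j, ann θ (1-r) j, ∫⁻ t in ⋃ k, ann θ (1-r) k, WW p fb a u t :=
        (lintegral_mono_set hcov).trans (lintegral_mono fun _ => lintegral_mono_set hcov)
    _ ≤ ∑' j, ∫⁻ u in ann θ (1-r) j, ∑' k, ∫⁻ t in ann θ (1-r) k, WW p fb a u t :=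
        (lintegral_iUnion_le _ _).trans (ENNReal.tsum_le_tsum fun j => lintegral_mono fun u => lintegral_iUnion_le _ _)
    _ = ∑' j, ∑' k, ∫⁻ u in ann θ (1-r) j, ∫⁻ t in ann θ (1-r) k, WW p fb a u t := by
        congr 1; ext j
        exact lintegral_tsum fun k => (WW_meas p hm a).lintegral_prod_right'.aemeasurable
    _ ≤ ∑' j, ∑' k, ENNReal.ofReal (400000 * m * (τ^j * τ^k)) := by
        refine ENNReal.tsum_le_tsum fun j => ENNReal.tsum_le_tsum fun k => ?_
        have := hT hm hm0 (norm_nonneg a) ha1 (hM θ) j k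
        rw [← hr', ← har] at this
        exact this
    _ = ENNReal.ofReal (400000 * m) * ((∑' j : ℕ, ENNReal.ofReal τ^j) * (∑' k : ℕ, ENNReal.ofReal τ^k)) := by
        rw [← ENNReal.tsum_mul_right, ← ENNReal.tsum_mul_left]
        congr 1; ext j
        rw [← ENNReal.tsum_mul_left, ← ENNReal.tsum_mul_left]
        congr 1; ext k
        rw [ENNReal.ofReal_mul (by positivity), ENNReal.ofReal_mul (p := τ^j) (by positivity), ENNReal.ofReal_pow ht0, ENNReal.ofReal_pow ht0]
    _ ≤ _ := by
        rw [ENNReal.tsum_geometric, ← ENNReal.ofReal_one, ← ENNReal.ofReal_sub _ ht0, ← ENNReal.ofReal_inv_of_pos ht2,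
          ← ENNReal.ofReal_mul (by positivity), ← ENNReal.ofReal_mul (by positivity)]
        refine ENNReal.ofReal_le_ofReal (le_of_eq ?_)
        field_simp


lemma hardy {p : ℝ} (hp0 : 0 < p) (hp1 : p < 1) : ∃ C : ℝ, 0 < C ∧ ∀ (g : ℝ → ℝ≥0∞), Measurable g → ∀ c : ℝ,
    ∫⁻ x in Ioc 0 c, ENNReal.ofReal (x^(p-2)) * (∫⁻ y in Ioc 0 x, g y)^2 ≤
      ENNReal.ofReal C * ∫⁻ y in Ioc 0 c, ENNReal.ofReal (y^p) * g y^2 := by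
  set β := (1+p)/2 with hβ
  have b1 : 0 < 1 - β := by rw [hβ]; linarith
  have b2 : 0 < β - p := by rw [hβ]; linarith
  refine ⟨1/(1-β) * (1/(β-p)), by positivity, fun g hg c => ?_⟩
  set G : ℝ → ℝ≥0∞ := fun y => ENNReal.ofReal (y^β) * g y^2 with hG
  have hGm : Measurable G := (by fun_prop : Measurable fun y : ℝ => ENNReal.ofReal (y^β)).mul (hg.pow_const 2)
  set w : ℝ → ℝ≥0∞ := fun x => ENNReal.ofReal (1/(1-β)) * ENNReal.ofReal (x^(p-1-β)) with hw
  have hwm : Measurable w := by rw [hw]; fun_prop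
  have hA : ∀ x ∈ Ioc 0 c, ENNReal.ofReal (x^(p-2)) * (∫⁻ y in Ioc 0 x, g y)^2 ≤ ∫⁻ y in Ioc 0 c, if y ≤ x then w x * G y else 0 := by
    intro x hx
    have hx0 := hx.1
    have h1 : (∫⁻ y in Ioc 0 x, g y) = ∫⁻ y in Ioc 0 x, ENNReal.ofReal (y^(-(β/2))) * (ENNReal.ofReal (y^(β/2)) * g y) := by
      refine setLIntegral_congr_fun measurableSet_Ioc fun y hy => ?_
      rw [← mul_assoc, ← ENNReal.ofReal_mul (Real.rpow_nonneg hy.1.le _), ← Real.rpow_add hy.1]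
      simp
    have h2 := lint_cs (μ := volume.restrict (Ioc 0 x)) (φ := fun y : ℝ => ENNReal.ofReal (y^(-(β/2)))) (ψ := fun y => ENNReal.ofReal (y^(β/2)) * g y)
      (by fun_prop) ((by fun_prop : Measurable fun y : ℝ => ENNReal.ofReal (y^(β/2))).mul hg).aemeasurable
    rw [← h1] at h2
    have e1 : ∫⁻ y in Ioc 0 x, ENNReal.ofReal (y^(-(β/2)))^2 = ENNReal.ofReal (x^(1-β)/(1-β)) := by
      rw [show 1 - β = -β + 1 by ring, ← lint_rpow_Ioc (by linarith) hx0.le]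
      refine setLIntegral_congr_fun measurableSet_Ioc fun y hy => ?_
      rw [← ENNReal.ofReal_pow (Real.rpow_nonneg hy.1.le _), ← Real.rpow_natCast, ← Real.rpow_mul hy.1.le]
      congr 2; push_cast; ring
    have e2 : ∫⁻ y in Ioc 0 x, (ENNReal.ofReal (y^(β/2)) * g y)^2 = ∫⁻ y in Ioc 0 x, G y := by
      refine setLIntegral_congr_fun measurableSet_Ioc fun y hy => ?_
      simp only [hG]
      rw [mul_pow, ← ENNReal.ofReal_pow (Real.rpow_nonneg hy.1.le _), ← Real.rpow_natCast, ← Real.rpow_mul hy.1.le]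
      congr 3; push_cast; ring
    rw [e1, e2] at h2
    refine (mul_le_mul_right h2 _).trans ?_
    have e3 : ENNReal.ofReal (x^(p-2)) * ENNReal.ofReal (x^(1-β)/(1-β)) = w x := by
      show _ = ENNReal.ofReal (1/(1-β)) * ENNReal.ofReal (x^(p-1-β))
      rw [← ENNReal.ofReal_mul (by positivity), ← ENNReal.ofReal_mul (by positivity)]
      congr 1
      rw [show p - 1 - β = (p-2) + (1-β) by ring, Real.rpow_add hx0]; ring
    rw [← mul_assoc, e3, ← lintegral_const_mul _ hGm]
    have e4 : ∀ y ∈ Ioc 0 x, w x * G y = if y ≤ x then w x * G y else 0 := by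
      intro y hy; rw [if_pos hy.2]
    rw [setLIntegral_congr_fun measurableSet_Ioc e4]
    exact lintegral_mono_set (Ioc_subset_Ioc_right hx.2)
  refine (setLIntegral_mono' measurableSet_Ioc hA).trans ?_
  have hmm : Measurable fun q : ℝ × ℝ => if q.2 ≤ q.1 then w q.1 * G q.2 else 0 := by
    refine Measurable.ite (measurableSet_le measurable_snd measurable_fst) ?_ measurable_const
    exact (hwm.comp measurable_fst).mul (hGm.comp measurable_snd)
  rw [lintegral_lintegral_swap hmm.aemeasurable, ← lintegral_const_mul' _ _ ENNReal.ofReal_ne_top]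
  refine setLIntegral_mono' measurableSet_Ioc fun y hy => ?_
  have hy0 := hy.1
  calc ∫⁻ x in Ioc 0 c, (if y ≤ x then w x * G y else 0) ≤ ∫⁻ x, (Ici y).indicator (fun x => w x * G y) x := by
        refine (setLIntegral_le_lintegral _ _).trans (lintegral_mono fun x => ?_)
        simp only [indicator, mem_Ici]; exact le_rfl
    _ = (∫⁻ x in Ioi y, w x) * G y := by
        rw [lintegral_indicator measurableSet_Ici, lintegral_mul_const _ hwm, restrict_Ioi_eq_restrict_Ici]
    _ = _ := by
        rw [hw, lintegral_const_mul' _ _ ENNReal.ofReal_ne_top, lint_rpow_Ioi (by linarith) hy0, hG]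
        simp only
        rw [← mul_assoc, ← mul_assoc, ← ENNReal.ofReal_mul (by positivity), ← ENNReal.ofReal_mul', ← ENNReal.ofReal_mul (by positivity)]
        swap
        · positivity
        congr 2
        rw [show p - 1 - β + 1 = p - β by ring, show -(p-β) = β - p by ring, Real.rpow_sub hy0]
        have : y^β ≠ 0 := by positivity
        field_simp

/-- radial-angular coordinates derivative -/
def gg (f : ℂ → ℂ) (x s : ℝ) : ℝ≥0∞ := ‖deriv f (((1 - x : ℝ):ℂ) * Complex.exp (Complex.I * s))‖ₑ

lemma gg_meas (f : ℂ → ℂ) : Measurable fun q : ℝ × ℝ => gg f q.1 q.2 := by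
  unfold gg
  have h1 : Measurable fun q : ℝ × ℝ => ((1 - q.1 : ℝ):ℂ) * Complex.exp (Complex.I * q.2) := by fun_prop
  exact ((measurable_deriv f).comp h1).enorm

/-- radial part -/
def AA (f : ℂ → ℂ) (s x : ℝ) : ℝ≥0∞ := ∫⁻ y in Ioc 0 x, gg f y s
/-- angular part -/
def BB (f : ℂ → ℂ) (s x : ℝ) : ℝ≥0∞ := ∫⁻ w in Icc (-(4*π*x)) (4*π*x), gg f x (s + w)

/-- main area integral -/
def PP (p : ℝ) (f : ℂ → ℂ) (J : Set ℝ) (c : ℝ) : ℝ≥0∞ :=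
  ∫⁻ s in J, ∫⁻ x in Ioc 0 c, ENNReal.ofReal (x^p) * gg f x s^2

lemma AA_meas (f : ℂ → ℂ) : Measurable fun q : ℝ × ℝ => AA f q.1 q.2 := by
  have h : ∀ q : ℝ × ℝ, AA f q.1 q.2 = ∫⁻ y, if 0 < y ∧ y ≤ q.2 then gg f y q.1 else 0 := by
    intro q
    rw [AA, ← lintegral_indicator measurableSet_Ioc]
    congr 1
    ext y; simp only [indicator, mem_Ioc]
  simp_rw [h]
  refine Measurable.lintegral_prod_right' (f := fun z : (ℝ × ℝ) × ℝ => if 0 < z.2 ∧ z.2 ≤ z.1.2 then gg f z.2 z.1.1 else 0) ?_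
  have p1 : Measurable fun z : (ℝ × ℝ) × ℝ => z.2 := measurable_snd
  have p2 : Measurable fun z : (ℝ × ℝ) × ℝ => z.1.2 := by fun_prop
  have p3 : Measurable fun z : (ℝ × ℝ) × ℝ => z.1.1 := by fun_prop
  refine Measurable.ite ((measurableSet_lt measurable_const p1).inter (measurableSet_le p1 p2)) ?_ measurable_const
  have : Measurable fun z : (ℝ × ℝ) × ℝ => (z.2, z.1.1) := p1.prodMk p3
  exact Measurable.comp (f := fun z : (ℝ × ℝ) × ℝ => (z.2, z.1.1)) (g := fun q : ℝ × ℝ => gg f q.1 q.2) (gg_meas f) this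

lemma BB_meas (f : ℂ → ℂ) : Measurable fun q : ℝ × ℝ => BB f q.1 q.2 := by
  have h : ∀ q : ℝ × ℝ, BB f q.1 q.2 = ∫⁻ y, if -(4*π*q.2) ≤ y ∧ y ≤ 4*π*q.2 then gg f q.2 (q.1 + y) else 0 := by
    intro q
    rw [BB, ← lintegral_indicator measurableSet_Icc]
    congr 1
    ext y; simp only [indicator, mem_Icc]
  simp_rw [h]
  refine Measurable.lintegral_prod_right' (f := fun z : (ℝ × ℝ) × ℝ => if -(4*π*z.1.2) ≤ z.2 ∧ z.2 ≤ 4*π*z.1.2 then gg f z.1.2 (z.1.1 + z.2) else 0) ?_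
  have p1 : Measurable fun z : (ℝ × ℝ) × ℝ => z.2 := measurable_snd
  have p2 : Measurable fun z : (ℝ × ℝ) × ℝ => z.1.2 := by fun_prop
  have p3 : Measurable fun z : (ℝ × ℝ) × ℝ => z.1.1 := by fun_prop
  refine Measurable.ite ((measurableSet_le (p2.const_mul _).neg p1).inter (measurableSet_le p1 (p2.const_mul _))) ?_ measurable_const
  have : Measurable fun z : (ℝ × ℝ) × ℝ => (z.1.2, z.1.1 + z.2) := p2.prodMk (p3.add p1)
  exact Measurable.comp (f := fun z : (ℝ × ℝ) × ℝ => (z.1.2, z.1.1 + z.2)) (g := fun q : ℝ × ℝ => gg f q.1 q.2) (gg_meas f) this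

lemma T2 {p : ℝ} (f : ℂ → ℂ) {θ h c : ℝ} (hc : c ≤ h/2) :
    ∫⁻ s in arcInterval θ h, ∫⁻ x in Ioc 0 c, ENNReal.ofReal (x^(p-2)) * BB f s x^2 ≤
      ENNReal.ofReal (64*π^2) * PP p f (arcInterval θ (3*h)) c := by
  have hpi := Real.pi_pos
  have hg2 : ∀ x, Measurable fun q : ℝ × ℝ => gg f x (q.1 + q.2)^2 := fun x => by
    have h1 : Measurable fun q : ℝ × ℝ => (x, q.1 + q.2) := by fun_prop
    exact (Measurable.comp (f := fun q : ℝ × ℝ => (x, q.1 + q.2)) (g := fun q : ℝ × ℝ => gg f q.1 q.2) (gg_meas f) h1).pow_const 2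
  have hg1 : ∀ x, Measurable fun s => gg f x s := fun x =>
    Measurable.comp (f := fun s : ℝ => (x, s)) (g := fun q : ℝ × ℝ => gg f q.1 q.2) (gg_meas f) (by fun_prop)
  have hB : ∀ s x, 0 < x → BB f s x^2 ≤ ENNReal.ofReal (8*π*x) * ∫⁻ w in Icc (-(4*π*x)) (4*π*x), gg f x (s+w)^2 := by
    intro s x hx
    have h1 := lint_cs (μ := volume.restrict (Icc (-(4*π*x)) (4*π*x))) (φ := fun _ : ℝ => 1) (ψ := fun w => gg f x (s+w))
      measurable_const.aemeasurable ((hg1 x).comp (measurable_const_add s)).aemeasurable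
    simp only [one_mul, one_pow, lintegral_const, Measure.restrict_apply_univ, Real.volume_Icc] at h1
    rw [show 4*π*x - -(4*π*x) = 8*π*x by ring] at h1
    exact h1
  have hpm : Measurable fun q : ℝ × ℝ => ENNReal.ofReal (q.2^(p-2)) * BB f q.1 q.2^2 :=
    (by fun_prop : Measurable fun q : ℝ × ℝ => ENNReal.ofReal (q.2^(p-2))).mul ((BB_meas f).pow_const 2)
  have hpm2 : Measurable fun q : ℝ × ℝ => ENNReal.ofReal (q.2^p) * gg f q.2 q.1^2 := by
    have h1 : Measurable fun q : ℝ × ℝ => (q.2, q.1) := by fun_prop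
    exact (by fun_prop : Measurable fun q : ℝ × ℝ => ENNReal.ofReal (q.2^p)).mul ((Measurable.comp (f := fun q : ℝ × ℝ => (q.2, q.1)) (g := fun q : ℝ × ℝ => gg f q.1 q.2) (gg_meas f) h1).pow_const 2)
  unfold PP
  have e : (∫⁻ s in arcInterval θ (3*h), ∫⁻ x in Ioc 0 c, ENNReal.ofReal (x^p)*gg f x s^2) = ∫⁻ x in Ioc 0 c, ∫⁻ s in arcInterval θ (3*h), ENNReal.ofReal (x^p)*gg f x s^2 := lintegral_lintegral_swap hpm2.aemeasurable
  rw [lintegral_lintegral_swap hpm.aemeasurable, e, ← lintegral_const_mul' _ _ ENNReal.ofReal_ne_top]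
  refine setLIntegral_mono' measurableSet_Ioc fun x hx => ?_
  have hx0 := hx.1
  have hshift : ∀ w ∈ Icc (-(4*π*x)) (4*π*x), ∫⁻ s in arcInterval θ h, gg f x (s+w)^2 ≤ ∫⁻ t in arcInterval θ (3*h), gg f x t^2 := by
    intro w hw
    have am : ∀ k, MeasurableSet (arcInterval θ k) := fun k => measurableSet_Ioo
    rw [← lintegral_indicator (am h), ← lintegral_indicator (am (3*h)),
      ← lintegral_add_right_eq_self (fun t => (arcInterval θ (3*h)).indicator (fun t => gg f x t^2) t) w]
    refine lintegral_mono fun s => ?_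
    by_cases hs : s ∈ arcInterval θ h
    · have hs2 : s + w ∈ arcInterval θ (3*h) := by
        have hxc := hx.2
        have h1 : 4*π*x ≤ 2*π*h := by nlinarith
        constructor <;> nlinarith [hs.1, hs.2, hw.1, hw.2]
      simp only [indicator_of_mem hs2]
      simp [indicator_of_mem hs]
    · simp [indicator_of_notMem hs]
  calc ∫⁻ s in arcInterval θ h, ENNReal.ofReal (x^(p-2)) * BB f s x^2
      ≤ ∫⁻ s in arcInterval θ h, ENNReal.ofReal (x^(p-2)) * (ENNReal.ofReal (8*π*x) * ∫⁻ w in Icc (-(4*π*x)) (4*π*x), gg f x (s+w)^2) :=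
        lintegral_mono fun s => mul_le_mul_right (hB s x hx0) _
    _ = ENNReal.ofReal (x^(p-2)) * (ENNReal.ofReal (8*π*x) * ∫⁻ w in Icc (-(4*π*x)) (4*π*x), ∫⁻ s in arcInterval θ h, gg f x (s+w)^2) := by
        rw [lintegral_const_mul' _ _ ENNReal.ofReal_ne_top, lintegral_const_mul' _ _ ENNReal.ofReal_ne_top, lintegral_lintegral_swap (hg2 x).aemeasurable]
    _ ≤ ENNReal.ofReal (x^(p-2)) * (ENNReal.ofReal (8*π*x) * ((∫⁻ t in arcInterval θ (3*h), gg f x t^2) * ENNReal.ofReal (8*π*x))) := by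
        refine mul_le_mul_right (mul_le_mul_right ((setLIntegral_mono' measurableSet_Icc hshift).trans (le_of_eq ?_)) _) _
        rw [setLIntegral_const, Real.volume_Icc]; congr 2; ring
    _ = _ := by
        rw [lintegral_const_mul' _ _ ENNReal.ofReal_ne_top, ← mul_assoc, mul_comm (lintegral _ _), ← mul_assoc, ← mul_assoc]
        congr 1
        rw [← ENNReal.ofReal_mul (by positivity), ← ENNReal.ofReal_mul (by positivity), ← ENNReal.ofReal_mul (by positivity)]
        congr 1
        rw [Real.rpow_sub hx0, Real.rpow_two]
        field_simp; norm_num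


lemma scale_int {φ : ℝ → ℝ≥0∞} (hφ : Measurable φ) {κ : ℝ} (hκ : 0 < κ) :
    ∫⁻ t, φ (κ⁻¹ * t) = ENNReal.ofReal κ * ∫⁻ x, φ x := by
  have h := Real.smul_map_volume_mul_left (a := κ⁻¹) (by positivity)
  have h2 : ∫⁻ x, φ x = ∫⁻ x, φ x ∂(ENNReal.ofReal |κ⁻¹| • Measure.map (fun x => κ⁻¹ * x) volume) := by rw [h]
  rw [h2, lintegral_smul_measure, lintegral_map hφ (measurable_const_mul _), smul_eq_mul, ← mul_assoc,
    ← ENNReal.ofReal_mul hκ.le, abs_of_pos (by positivity), mul_inv_cancel₀ hκ.ne', ENNReal.ofReal_one, one_mul]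

lemma U1 {φ : ℝ → ℝ≥0∞} (hφ : Measurable φ) {κ c η : ℝ} (hκ : 0 < κ) (hc : π * η ≤ κ * c) (s : ℝ) :
    ∫⁻ u in arcInterval s η, φ (κ⁻¹ * |u - s|) ≤ ENNReal.ofReal (2*κ) * ∫⁻ x in Ioc 0 c, φ x := by
  set F : ℝ → ℝ≥0∞ := fun t => (Ioc 0 c).indicator φ (κ⁻¹ * t) with hF
  have hi : Measurable ((Ioc 0 c).indicator φ) := hφ.indicator measurableSet_Ioc
  have hFm : Measurable F := hi.comp (measurable_const_mul _)
  have hFi : ∫⁻ t, F t = ENNReal.ofReal κ * ∫⁻ x in Ioc 0 c, φ x := by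
    rw [hF, scale_int hi hκ, lintegral_indicator measurableSet_Ioc]
  have h1 : ∫⁻ u in arcInterval s η, φ (κ⁻¹ * |u - s|) ≤ ∫⁻ u, (F (u - s) + F (s - u)) := by
    refine le_trans ?_ (setLIntegral_le_lintegral (arcInterval s η) _)
    refine setLIntegral_mono_ae' measurableSet_Ioo ?_
    have hne : ∀ᵐ u : ℝ, u ≠ s := by
      rw [ae_iff]; simp
    filter_upwards [hne] with u hu hu2
    have hu3 : |u - s| < π * η := mem_arc.1 hu2
    have hpos : 0 < |u - s| := abs_pos.2 (sub_ne_zero.2 hu)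
    have hm : κ⁻¹ * |u - s| ∈ Ioc 0 c := by
      refine ⟨by positivity, ?_⟩
      rw [inv_mul_le_iff₀ hκ]; linarith
    rcases abs_cases (u - s) with ⟨e, _⟩ | ⟨e, _⟩
    · refine le_trans (le_of_eq ?_) le_self_add
      rw [e] at hm ⊢
      simp only [hF]; rw [indicator_of_mem hm]
    · refine le_trans (le_of_eq ?_) le_add_self
      rw [e, neg_sub] at hm ⊢
      simp only [hF]; rw [indicator_of_mem hm]
  refine h1.trans (le_of_eq ?_)
  have m1 : Measurable fun u => F (u - s) := hFm.comp (measurable_id.sub_const s)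
  rw [lintegral_add_left m1, lintegral_sub_right_eq_self F s, lintegral_sub_left_eq_self F s, hFi,
    ← two_mul, ← mul_assoc, ENNReal.ofReal_mul (by norm_num)]
  simp

lemma U3 {φ : ℝ → ℝ → ℝ≥0∞} (hφ : Measurable fun q : ℝ × ℝ => φ q.1 q.2) {κ c η h θ : ℝ} (hκ : 0 < κ) (hc : π * η ≤ κ * c)
    (hη : η ≤ 2*h) :
    ∫⁻ s in arcInterval θ h, ∫⁻ u in arcInterval s η, φ u (κ⁻¹ * |u - s|) ≤
      ENNReal.ofReal (2*κ) * ∫⁻ u in arcInterval θ (3*h), ∫⁻ x in Ioc 0 c, φ u x := by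
  have hpi := Real.pi_pos
  set G : ℝ → ℝ → ℝ≥0∞ := fun s u => if |u - s| < π * η then φ u (κ⁻¹ * |u - s|) else 0 with hG
  have hGm : Measurable fun q : ℝ × ℝ => G q.1 q.2 := by
    have hd : Measurable fun q : ℝ × ℝ => |q.2 - q.1| := by
      have : Continuous fun q : ℝ × ℝ => |q.2 - q.1| := by fun_prop
      exact this.measurable
    have hp : Measurable fun q : ℝ × ℝ => (q.2, κ⁻¹ * |q.2 - q.1|) := measurable_snd.prodMk (hd.const_mul _)
    exact Measurable.ite (measurableSet_lt hd measurable_const)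
      (Measurable.comp (f := fun q : ℝ × ℝ => (q.2, κ⁻¹ * |q.2 - q.1|)) (g := fun q : ℝ × ℝ => φ q.1 q.2) hφ hp) measurable_const
  have am : ∀ θ k, MeasurableSet (arcInterval θ k) := fun θ k => measurableSet_Ioo
  have h1 : ∀ s ∈ arcInterval θ h, ∫⁻ u in arcInterval s η, φ u (κ⁻¹ * |u - s|) ≤ ∫⁻ u in arcInterval θ (3*h), G s u := by
    intro s hs
    have hsub : arcInterval s η ⊆ arcInterval θ (3*h) := by
      intro u hu
      have := mul_le_mul_of_nonneg_left hη hpi.le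
      constructor <;> linarith [hs.1, hs.2, hu.1, hu.2]
    refine le_trans (le_of_eq ?_) (lintegral_mono_set hsub)
    refine setLIntegral_congr_fun (am s η) fun u hu => ?_
    have := mem_arc.1 hu
    simp only [hG]; rw [if_pos this]
  refine (setLIntegral_mono' (am θ h) h1).trans ?_
  rw [lintegral_lintegral_swap hGm.aemeasurable, ← lintegral_const_mul' _ _ ENNReal.ofReal_ne_top]
  refine lintegral_mono fun u => ?_
  have hφu : Measurable (φ u) := Measurable.comp (f := fun x : ℝ => (u, x)) (g := fun q : ℝ × ℝ => φ q.1 q.2) hφ (by fun_prop)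
  refine le_trans ?_ (U1 hφu hκ hc u)
  rw [← lintegral_indicator (am u η)]
  refine (setLIntegral_le_lintegral _ _).trans (lintegral_mono fun s => ?_)
  simp only [hG, indicator, mem_arc, abs_sub_comm s u]
  exact le_rfl


lemma ftc_bd {γ γ' : ℝ → ℂ} {a b : ℝ} (hab : a ≤ b) (hd : ∀ y ∈ Icc a b, HasDerivAt γ (γ' y) y)
    (hc : ContinuousOn γ' (Icc a b)) : ‖γ b - γ a‖ₑ ≤ ∫⁻ y in Ioc a b, ‖γ' y‖ₑ := by
  have h1 : ∫ y in a..b, γ' y = γ b - γ a := by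
    refine intervalIntegral.integral_eq_sub_of_hasDerivAt (fun y hy => hd y (by rwa [uIcc_of_le hab] at hy)) ?_
    exact ContinuousOn.intervalIntegrable (by rwa [uIcc_of_le hab])
  rw [← h1, intervalIntegral.integral_of_le hab]
  exact enorm_integral_le_lintegral_enorm _

lemma ray_mem {y s : ℝ} (h0 : 0 < y) (h1 : y ≤ 1) : ((1 - y : ℝ):ℂ) * Complex.exp (Complex.I * s) ∈ unitDisk := by
  rw [mem_unitDisk, norm_mul, norm_ee, mul_one, Complex.norm_real, Real.norm_eq_abs, abs_of_nonneg (by linarith)]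
  linarith

lemma disk_open : IsOpen unitDisk := Metric.isOpen_ball

lemma rad_bd {f : ℂ → ℂ} (hf : DifferentiableOn ℂ f unitDisk) {s x : ℝ} {v : ℂ} (hx0 : 0 < x) (hx1 : x ≤ 1)
    (hv : Tendsto (fun r : ℝ => f ((r : ℂ) * Complex.exp (Complex.I * s))) (nhdsWithin 1 (Set.Iio 1)) (nhds v)) :
    ‖v - f (((1 - x : ℝ):ℂ) * Complex.exp (Complex.I * s))‖ₑ ≤ AA f s x := by
  have hev : ∀ᶠ r : ℝ in nhdsWithin 1 (Set.Iio 1), ‖f ((r : ℂ) * Complex.exp (Complex.I * s)) - f (((1 - x : ℝ):ℂ) * Complex.exp (Complex.I * s))‖ₑ ≤ AA f s x := by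
    have : Ioo (1-x) 1 ∈ nhdsWithin (1:ℝ) (Set.Iio 1) := Ioo_mem_nhdsLT (by linarith)
    filter_upwards [this] with r hr
    set ε := 1 - r with hε
    have hr' : r = 1 - ε := by rw [hε]; ring
    have e0 : 0 < ε := by rw [hε]; linarith [hr.2]
    have e1 : ε ≤ x := by rw [hε]; linarith [hr.1]
    rw [hr', ← enorm_neg, neg_sub]
    have hk := ftc_bd (γ := fun y : ℝ => f (((1 - y : ℝ):ℂ) * Complex.exp (Complex.I * s)))
      (γ' := fun y : ℝ => deriv f (((1 - y : ℝ):ℂ) * Complex.exp (Complex.I * s)) * (-1 * Complex.exp (Complex.I * s))) e1 ?_ ?_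
    · refine hk.trans ?_
      have : ∀ y : ℝ, ‖deriv f (((1 - y : ℝ):ℂ) * Complex.exp (Complex.I * s)) * (-1 * Complex.exp (Complex.I * s))‖ₑ = gg f y s := by
        intro y
        rw [gg, enorm_mul]
        have : ‖-1 * Complex.exp (Complex.I * s)‖ₑ = 1 := by
          rw [neg_one_mul, enorm_neg, ← ofReal_norm, norm_ee, ENNReal.ofReal_one]
        rw [this, mul_one]
      simp_rw [this]
      exact lintegral_mono_set (Ioc_subset_Ioc_left e0.le)
    · intro y hy
      have hm : ((1 - y : ℝ):ℂ) * Complex.exp (Complex.I * s) ∈ unitDisk := ray_mem (e0.trans_le hy.1) (hy.2.trans hx1)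
      have h1 := (hf.differentiableAt (disk_open.mem_nhds hm)).hasDerivAt
      have h2 : HasDerivAt (fun y : ℝ => ((1 - y : ℝ):ℂ) * Complex.exp (Complex.I * s)) (-1 * Complex.exp (Complex.I * s)) y := by
        have h3 : HasDerivAt (fun y : ℝ => ((1 - y : ℝ):ℂ)) (-1) y := by
          have := ((hasDerivAt_id y).const_sub 1).ofReal_comp
          simpa using this
        exact h3.mul_const _
      exact HasDerivAt.comp y h1 h2
    · refine ContinuousOn.mul ?_ continuousOn_const
      refine (hf.deriv disk_open).continuousOn.comp (by fun_prop) ?_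
      intro y hy
      exact ray_mem (e0.trans_le hy.1) (hy.2.trans hx1)
  have hlim : Tendsto (fun r : ℝ => ‖f ((r : ℂ) * Complex.exp (Complex.I * s)) - f (((1 - x : ℝ):ℂ) * Complex.exp (Complex.I * s))‖ₑ)
      (nhdsWithin 1 (Set.Iio 1)) (nhds ‖v - f (((1 - x : ℝ):ℂ) * Complex.exp (Complex.I * s))‖ₑ) :=
    (hv.sub_const _).enorm
  exact le_of_tendsto hlim hev

lemma ang_bd {f : ℂ → ℂ} (hf : DifferentiableOn ℂ f unitDisk) {a b x : ℝ} (hx0 : 0 < x) (hx1 : x ≤ 1) (hab : a ≤ b) :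
    ‖f (((1 - x : ℝ):ℂ) * Complex.exp (Complex.I * b)) - f (((1 - x : ℝ):ℂ) * Complex.exp (Complex.I * a))‖ₑ ≤
      ∫⁻ t in Ioc a b, gg f x t := by
  have hk := ftc_bd (γ := fun t : ℝ => f (((1 - x : ℝ):ℂ) * Complex.exp (Complex.I * t)))
      (γ' := fun t : ℝ => deriv f (((1 - x : ℝ):ℂ) * Complex.exp (Complex.I * t)) * (((1 - x : ℝ):ℂ) * (Complex.exp (Complex.I * t) * (Complex.I * 1)))) hab ?_ ?_
  · refine hk.trans (lintegral_mono fun t => ?_)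
    rw [enorm_mul, gg]
    have : ‖((1 - x : ℝ):ℂ) * (Complex.exp (Complex.I * t) * (Complex.I * 1))‖ₑ ≤ 1 := by
      rw [← ofReal_norm, norm_mul, norm_mul, norm_ee, Complex.norm_real, Real.norm_eq_abs, abs_of_nonneg (by linarith)]
      simp only [mul_one, Complex.norm_I]
      exact ENNReal.ofReal_le_one.2 (by linarith)
    exact mul_le_of_le_one_right' this
  · intro y hy
    have hm : ((1 - x : ℝ):ℂ) * Complex.exp (Complex.I * y) ∈ unitDisk := ray_mem hx0 hx1
    have h1 := (hf.differentiableAt (disk_open.mem_nhds hm)).hasDerivAt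
    have h2 : HasDerivAt (fun t : ℝ => ((1 - x : ℝ):ℂ) * Complex.exp (Complex.I * t)) (((1 - x : ℝ):ℂ) * (Complex.exp (Complex.I * y) * (Complex.I * 1))) y := by
      have h3 : HasDerivAt (fun t : ℝ => (t:ℂ)) 1 y := by
        simpa using (hasDerivAt_id y).ofReal_comp
      exact ((h3.const_mul _).cexp).const_mul _
    exact HasDerivAt.comp y h1 h2
  · refine ContinuousOn.mul ?_ (by fun_prop)
    refine (hf.deriv disk_open).continuousOn.comp (by fun_prop) ?_
    intro y hy
    exact ray_mem hx0 hx1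

lemma bb_bd {f : ℂ → ℂ} {s a b x : ℝ} (ha : s - 4*π*x ≤ a) (hb : b ≤ s + 4*π*x) :
    ∫⁻ t in Ioc a b, gg f x t ≤ BB f s x := by
  have e : BB f s x = ∫⁻ t in Icc (s - 4*π*x) (s + 4*π*x), gg f x t := by
    rw [BB, ← lintegral_indicator measurableSet_Icc, ← lintegral_indicator measurableSet_Icc,
      ← lintegral_add_left_eq_self (fun t => (Icc (s - 4*π*x) (s + 4*π*x)).indicator (fun t => gg f x t) t) s]
    refine lintegral_congr fun w => ?_
    simp only [indicator, mem_Icc]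
    congr 1
    refine propext ⟨fun h => ⟨by linarith [h.1], by linarith [h.2]⟩, fun h => ⟨by linarith [h.1], by linarith [h.2]⟩⟩
  rw [e]
  exact lintegral_mono_set (Ioc_subset_Icc_self.trans (Icc_subset_Icc ha hb))

lemma pt_bd {f : ℂ → ℂ} (hf : DifferentiableOn ℂ f unitDisk) {s u x : ℝ} {v w : ℂ} (hx0 : 0 < x) (hx1 : x ≤ 1)
    (hx : |u - s| = 4*π*x)
    (hv : Tendsto (fun r : ℝ => f ((r : ℂ) * Complex.exp (Complex.I * s))) (nhdsWithin 1 (Set.Iio 1)) (nhds v))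
    (hw : Tendsto (fun r : ℝ => f ((r : ℂ) * Complex.exp (Complex.I * u))) (nhdsWithin 1 (Set.Iio 1)) (nhds w)) :
    ‖v - w‖ₑ ≤ AA f s x + BB f s x + AA f u x := by
  set zs := ((1 - x : ℝ):ℂ) * Complex.exp (Complex.I * s) with hzs
  set zu := ((1 - x : ℝ):ℂ) * Complex.exp (Complex.I * u) with hzu
  have h1 : ‖v - f zs‖ₑ ≤ AA f s x := rad_bd hf hx0 hx1 hv
  have h2 : ‖w - f zu‖ₑ ≤ AA f u x := rad_bd hf hx0 hx1 hw
  have hle := abs_le.1 hx.le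
  have hp : 0 < 4*π*x := by have := Real.pi_pos; positivity
  have h3 : ‖f zs - f zu‖ₑ ≤ BB f s x := by
    rcases le_total s u with h | h
    · rw [← enorm_neg, neg_sub]
      exact (ang_bd hf hx0 hx1 h).trans (bb_bd (by linarith) (by linarith))
    · exact (ang_bd hf hx0 hx1 h).trans (bb_bd (by linarith) (by linarith))
  have e : v - w = (v - f zs) + (f zs - f zu) + -(w - f zu) := by ring
  rw [e]
  refine (enorm_add_le _ _).trans (add_le_add ((enorm_add_le _ _).trans (add_le_add h1 h3)) ?_)
  rw [enorm_neg]; exact h2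

lemma sq3 (a b c : ℝ≥0∞) : (a + b + c)^2 ≤ 3 * (a^2 + b^2 + c^2) := by
  have h1 : ∀ x y : ℝ≥0∞, 2*(x*y) ≤ x^2 + y^2 := by
    intro x y
    rcases le_total x y with h | h
    · obtain ⟨d, rfl⟩ := exists_add_of_le h
      have : x^2 + (x+d)^2 = 2*(x*(x+d)) + d^2 := by ring
      rw [this]; exact le_self_add
    · obtain ⟨d, rfl⟩ := exists_add_of_le h
      have : (y+d)^2 + y^2 = 2*((y+d)*y) + d^2 := by ring
      rw [this]; exact le_self_add
  calc (a+b+c)^2 = a^2+b^2+c^2 + (2*(a*b) + 2*(b*c) + 2*(a*c)) := by ring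
    _ ≤ a^2+b^2+c^2 + ((a^2+b^2) + (b^2+c^2) + (a^2+c^2)) := by gcongr <;> apply h1
    _ = _ := by ring


lemma exp_per : Function.Periodic (fun t : ℝ => Complex.exp (Complex.I * t)) (2*π) := by
  intro t
  have := Complex.exp_periodic (Complex.I * t)
  simp only
  rw [← this]; congr 1; push_cast; ring

lemma bint_per (p : ℝ) {fb : ℝ → ℂ} (hper : Function.Periodic fb (2*π)) (s : ℝ) : Function.Periodic (bint p fb s) (2*π) := by
  intro u
  have := exp_per u
  simp only at this
  unfold bint
  rw [hper u, this]

lemma red1 (p : ℝ) {fb : ℝ → ℂ} (hper : Function.Periodic fb (2*π)) {θ h : ℝ} (hh : h ∈ Ioc (0:ℝ) 1) :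
    qpTDouble p fb θ h ≤ ∫⁻ s in arcInterval θ h, ∫⁻ u in arcInterval s (min (2*h) 1), bint p fb s u := by
  unfold qpTDouble
  have am : ∀ θ k, MeasurableSet (arcInterval θ k) := fun θ k => measurableSet_Ioo
  refine setLIntegral_mono' (am _ _) fun s hs => ?_
  change ∫⁻ u in arcInterval θ h, bint p fb s u ≤ _
  have hpi := Real.pi_pos
  rcases le_total (2*h) 1 with h1 | h1
  · rw [min_eq_left h1]
    refine lintegral_mono_set fun u hu => ?_
    constructor <;> linarith [hs.1, hs.2, hu.1, hu.2]
  · rw [min_eq_right h1, ← per_int' (bint_per p hper s) 0 s, per_int' (bint_per p hper s) 0 θ]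
    exact lintegral_mono_set (arc_mono hh.2)

lemma bint_le {p : ℝ} (hp1 : p < 1) (fb : ℝ → ℂ) {s u : ℝ} (hne : u ≠ s) (hle : |u - s| ≤ π) :
    bint p fb s u ≤ ENNReal.ofReal (((4*π)⁻¹ * |u - s|)^(p-2)) * ‖fb s - fb u‖ₑ^2 := by
  have hpi := Real.pi_pos
  have hpos : 0 < |u - s| := abs_pos.2 (sub_ne_zero.2 hne)
  set x := (4*π)⁻¹ * |u - s| with hx
  have hx0 : 0 < x := by positivity
  have hux : |u - s| = 4*π*x := by rw [hx]; field_simp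
  have h1 := ee_sub_ge (s := s) (u := u) (by rwa [abs_sub_comm])
  rw [abs_sub_comm, hux] at h1
  have h2 : x ≤ ‖Complex.exp (Complex.I * s) - Complex.exp (Complex.I * u)‖ := by
    have : 2/π * (4*π*x) = 8*x := by field_simp; norm_num
    linarith
  rw [bint, ← ofReal_sq_norm, ← ENNReal.ofReal_mul (by positivity)]
  refine ENNReal.ofReal_le_ofReal ?_
  have h3 : x^(2-p) ≤ ‖Complex.exp (Complex.I * s) - Complex.exp (Complex.I * u)‖^(2-p) := Real.rpow_le_rpow hx0.le h2 (by linarith)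
  have h4 : 0 < x^(2-p) := Real.rpow_pos_of_pos hx0 _
  rw [show p - 2 = -(2-p) by ring, Real.rpow_neg hx0.le, mul_comm (x^(2-p))⁻¹, ← div_eq_mul_inv]
  exact div_le_div_of_nonneg_left (sq_nonneg _) h4 h3

/-- weighted radial part -/
def P1 (p : ℝ) (f : ℂ → ℂ) (s x : ℝ) : ℝ≥0∞ := ENNReal.ofReal (x^(p-2)) * AA f s x^2
/-- weighted angular part -/
def P2 (p : ℝ) (f : ℂ → ℂ) (s x : ℝ) : ℝ≥0∞ := ENNReal.ofReal (x^(p-2)) * BB f s x^2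

lemma P1_meas (p : ℝ) (f : ℂ → ℂ) : Measurable fun q : ℝ × ℝ => P1 p f q.1 q.2 :=
  (by fun_prop : Measurable fun q : ℝ × ℝ => ENNReal.ofReal (q.2^(p-2))).mul ((AA_meas f).pow_const 2)
lemma P2_meas (p : ℝ) (f : ℂ → ℂ) : Measurable fun q : ℝ × ℝ => P2 p f q.1 q.2 :=
  (by fun_prop : Measurable fun q : ℝ × ℝ => ENNReal.ofReal (q.2^(p-2))).mul ((BB_meas f).pow_const 2)

lemma bint_pt {p : ℝ} (hp1 : p < 1) {f : ℂ → ℂ} (hf : DifferentiableOn ℂ f unitDisk) {fb : ℝ → ℂ} {s u : ℝ} (hne : u ≠ s) (hle : |u - s| ≤ π)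
    (hv : Tendsto (fun r : ℝ => f ((r : ℂ) * Complex.exp (Complex.I * s))) (nhdsWithin 1 (Set.Iio 1)) (nhds (fb s)))
    (hw : Tendsto (fun r : ℝ => f ((r : ℂ) * Complex.exp (Complex.I * u))) (nhdsWithin 1 (Set.Iio 1)) (nhds (fb u))) :
    bint p fb s u ≤ 3 * (P1 p f s ((4*π)⁻¹ * |u - s|) + P2 p f s ((4*π)⁻¹ * |u - s|)) + 3 * P1 p f u ((4*π)⁻¹ * |u - s|) := by
  have hpi := Real.pi_pos
  have hpos : 0 < |u - s| := abs_pos.2 (sub_ne_zero.2 hne)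
  refine (bint_le hp1 fb hne hle).trans ?_
  set x := (4*π)⁻¹ * |u - s| with hx
  have hx0 : 0 < x := by positivity
  have hux : |u - s| = 4*π*x := by rw [hx]; field_simp
  have hx1 : x ≤ 1 := by nlinarith
  have h1 := pt_bd hf hx0 hx1 hux hv hw
  have h2 : ‖fb s - fb u‖ₑ^2 ≤ 3 * (AA f s x^2 + BB f s x^2 + AA f u x^2) := (pow_le_pow_left' h1 2).trans (sq3 _ _ _)
  refine (mul_le_mul_right h2 _).trans (le_of_eq ?_)
  unfold P1 P2
  ring

lemma dirB1 {p : ℝ} (hp0 : 0 < p) (hp1 : p < 1) : ∃ C : ℝ, 0 < C ∧ ∀ (f : ℂ → ℂ) (fb : ℝ → ℂ), DifferentiableOn ℂ f unitDisk →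
    Function.Periodic fb (2*π) → RadialLimit f fb → ∀ θ : ℝ, ∀ h ∈ Ioc (0:ℝ) 1,
    qpTDouble p fb θ h ≤ ENNReal.ofReal C * PP p f (arcInterval θ (3*h)) (h/2) := by
  obtain ⟨CH, hCH, hH⟩ := hardy hp0 hp1
  have hpi := Real.pi_pos
  refine ⟨3 * (2*(4*π)) * (CH + 64*π^2 + CH), by positivity, fun f fb hf hper hR θ h hh => ?_⟩
  have h0 := hh.1
  have am : ∀ θ k, MeasurableSet (arcInterval θ k) := fun θ k => measurableSet_Ioo
  have hκ : 0 < 4*π := by positivity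
  set η := min (2*h) 1 with hη
  have hη1 : η ≤ 1 := min_le_right _ _
  have hη2 : η ≤ 2*h := min_le_left _ _
  have hc : π * η ≤ 4*π*(h/2) := by nlinarith
  have hsl1 : ∀ s, Measurable (P1 p f s) := fun s => Measurable.comp (f := fun x : ℝ => (s, x)) (g := fun q : ℝ × ℝ => P1 p f q.1 q.2) (P1_meas p f) (by fun_prop)
  have hsl2 : ∀ s, Measurable (P2 p f s) := fun s => Measurable.comp (f := fun x : ℝ => (s, x)) (g := fun q : ℝ × ℝ => P2 p f q.1 q.2) (P2_meas p f) (by fun_prop)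
  have hga : ∀ s, Measurable fun y => gg f y s := fun s =>
    Measurable.comp (f := fun y : ℝ => (y, s)) (g := fun q : ℝ × ℝ => gg f q.1 q.2) (gg_meas f) (by fun_prop)
  have hPmono : PP p f (arcInterval θ h) (h/2) ≤ PP p f (arcInterval θ (3*h)) (h/2) := lintegral_mono_set (arc_mono (by linarith))
  set Q := PP p f (arcInterval θ (3*h)) (h/2) with hQ
  have hP1 : ∀ J : Set ℝ, ∫⁻ s in J, ∫⁻ x in Ioc 0 (h/2), P1 p f s x ≤ ENNReal.ofReal CH * PP p f J (h/2) := by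
    intro J
    rw [PP, ← lintegral_const_mul' _ _ ENNReal.ofReal_ne_top]
    exact lintegral_mono fun s => hH _ (hga s) _
  have hP2 : ∫⁻ s in arcInterval θ h, ∫⁻ x in Ioc 0 (h/2), P2 p f s x ≤ ENNReal.ofReal (64*π^2) * Q := T2 f le_rfl
  have hi1 : Measurable fun s => ∫⁻ x in Ioc 0 (h/2), P1 p f s x := (P1_meas p f).lintegral_prod_right'
  have hi2 : Measurable fun s => ∫⁻ x in Ioc 0 (h/2), P2 p f s x := (P2_meas p f).lintegral_prod_right'
  set K : ℝ → ℝ≥0∞ := fun s => 3 * (ENNReal.ofReal (2*(4*π)) * ((∫⁻ x in Ioc 0 (h/2), P1 p f s x) + ∫⁻ x in Ioc 0 (h/2), P2 p f s x)) with hK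
  have hKm : Measurable K := ((hi1.add hi2).const_mul _).const_mul _
  have key : ∀ᵐ s : ℝ, s ∈ arcInterval θ h → ∫⁻ u in arcInterval s η, bint p fb s u ≤
      K s + 3 * ∫⁻ u in arcInterval s η, P1 p f u ((4*π)⁻¹ * |u - s|) := by
    filter_upwards [hR] with s hs _
    have hne : ∀ᵐ u : ℝ, u ≠ s := by
      rw [ae_iff]; simp
    have hsum : Measurable fun x => 3 * (P1 p f s x + P2 p f s x) := ((hsl1 s).add (hsl2 s)).const_mul _
    have hab : Measurable fun u : ℝ => (4*π)⁻¹ * |u - s| := by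
      have : Continuous fun u : ℝ => (4*π)⁻¹ * |u - s| := by fun_prop
      exact this.measurable
    have hsumc : Measurable fun u : ℝ => 3 * (P1 p f s ((4*π)⁻¹ * |u - s|) + P2 p f s ((4*π)⁻¹ * |u - s|)) := hsum.comp hab
    calc ∫⁻ u in arcInterval s η, bint p fb s u
        ≤ ∫⁻ u in arcInterval s η, (3 * (P1 p f s ((4*π)⁻¹ * |u - s|) + P2 p f s ((4*π)⁻¹ * |u - s|)) + 3 * P1 p f u ((4*π)⁻¹ * |u - s|)) := by
          refine setLIntegral_mono_ae' (am _ _) ?_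
          filter_upwards [hR, hne] with u hu hu2 hu3
          refine bint_pt hp1 hf hu2 ?_ hs hu
          have := mem_arc.1 hu3
          nlinarith
      _ = (∫⁻ u in arcInterval s η, 3 * (P1 p f s ((4*π)⁻¹ * |u - s|) + P2 p f s ((4*π)⁻¹ * |u - s|))) + 3 * ∫⁻ u in arcInterval s η, P1 p f u ((4*π)⁻¹ * |u - s|) := by
          rw [lintegral_add_left hsumc, lintegral_const_mul' 3 _ (by norm_num), lintegral_const_mul' 3 _ (by norm_num)]
      _ ≤ _ := by
          refine add_le_add ?_ le_rfl
          refine (U1 hsum hκ hc s).trans (le_of_eq ?_)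
          rw [lintegral_const_mul' 3 _ (by norm_num), lintegral_add_left (hsl1 s), hK]
          ring
  refine (red1 p hper hh).trans ((setLIntegral_mono_ae' (am _ _) key).trans ?_)
  rw [lintegral_add_left hKm, lintegral_const_mul' 3 _ (by norm_num), lintegral_const_mul' 3 _ (by norm_num),
    lintegral_const_mul' _ _ ENNReal.ofReal_ne_top, lintegral_add_left hi1]
  have hU3 := U3 (P1_meas p f) hκ hc hη2 (θ := θ)
  calc _ ≤ 3 * (ENNReal.ofReal (2*(4*π)) * (ENNReal.ofReal CH * Q + ENNReal.ofReal (64*π^2) * Q)) + 3 * (ENNReal.ofReal (2*(4*π)) * (ENNReal.ofReal CH * Q)) := by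
        refine add_le_add (mul_le_mul_right (mul_le_mul_right (add_le_add ?_ hP2) _) _) (mul_le_mul_right (hU3.trans (mul_le_mul_right (hP1 _) _)) _)
        exact (hP1 _).trans (mul_le_mul_right hPmono _)
    _ = _ := by
        have e : ENNReal.ofReal (3 * (2*(4*π)) * (CH + 64*π^2 + CH)) = 3 * ENNReal.ofReal (2*(4*π)) * (ENNReal.ofReal CH + ENNReal.ofReal (64*π^2) + ENNReal.ofReal CH) := by
          rw [ENNReal.ofReal_mul (by positivity), ENNReal.ofReal_mul (p := 3) (by positivity), ENNReal.ofReal_add (by positivity) (by positivity),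
            ENNReal.ofReal_add (by positivity) (by positivity), ENNReal.ofReal_ofNat]
        rw [e]
        ring


lemma polar_bd {G : ℂ → ℝ≥0∞} (hG : Measurable G) :
    ∫⁻ s in arcInterval 0 1, ∫⁻ x in Ioc (0:ℝ) (1/2), G (((1 - x : ℝ):ℂ) * Complex.exp (Complex.I * s)) ≤ 2 * ∫⁻ z, G z := by
  have hm : Measurable fun q : ℝ × ℝ => ENNReal.ofReal q.1 * G ((q.1:ℂ) * Complex.exp (Complex.I * q.2)) := by
    have h1 : Measurable fun q : ℝ × ℝ => (q.1:ℂ) * Complex.exp (Complex.I * q.2) := by fun_prop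
    exact (by fun_prop : Measurable fun q : ℝ × ℝ => ENNReal.ofReal q.1).mul (hG.comp h1)
  have e : ∫⁻ z, G z = ∫⁻ s in arcInterval 0 1, ∫⁻ r in Ioi (0:ℝ), ENNReal.ofReal r * G ((r:ℂ) * Complex.exp (Complex.I * s)) := by
    rw [← Complex.lintegral_comp_polarCoord_symm, _root_.polarCoord_target]
    have : arcInterval 0 1 = Ioo (-π) π := by simp [arcInterval]
    rw [this]
    have h2 := setLIntegral_prod_symm (μ := (volume : Measure ℝ)) (ν := (volume : Measure ℝ)) (s := Ioi (0:ℝ)) (t := Ioo (-π) π) _ hm.aemeasurable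
    rw [← h2]
    refine lintegral_congr fun q => ?_
    rw [Complex.polarCoord_symm_apply, smul_eq_mul]
    congr 3
    rw [mul_comm Complex.I, Complex.exp_mul_I]
    push_cast; rfl
  rw [e, ← lintegral_const_mul' _ _ (by norm_num)]
  refine lintegral_mono fun s => ?_
  rw [← lintegral_const_mul' _ _ (by norm_num), ← lintegral_indicator measurableSet_Ioi, ← lintegral_indicator measurableSet_Ioc]
  rw [← lintegral_sub_left_eq_self (fun r => (Ioi (0:ℝ)).indicator (fun r => 2 * (ENNReal.ofReal r * G ((r:ℂ) * Complex.exp (Complex.I * s)))) r) 1]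
  refine lintegral_mono fun x => ?_
  by_cases hx : x ∈ Ioc (0:ℝ) (1/2)
  · have hx2 : 1 - x ∈ Ioi (0:ℝ) := by simp only [mem_Ioi]; linarith [hx.2]
    rw [indicator_of_mem hx, indicator_of_mem hx2, ← mul_assoc]
    have : 1 ≤ 2 * ENNReal.ofReal (1 - x) := by
      rw [show (2:ℝ≥0∞) = ENNReal.ofReal 2 by simp, ← ENNReal.ofReal_mul (by norm_num), ← ENNReal.ofReal_one]
      exact ENNReal.ofReal_le_ofReal (by linarith [hx.2])
    exact le_mul_of_one_le_left' this
  · rw [indicator_of_notMem hx]; exact zero_le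

lemma three_per {H : ℝ → ℝ≥0∞} (hH : Function.Periodic H (2*π)) (θ : ℝ) :
    ∫⁻ s in arcInterval θ 3, H s ≤ 3 * ∫⁻ s in arcInterval 0 1, H s := by
  have hpi := Real.pi_pos
  have hsub : arcInterval θ 3 ⊆ (Ioc (θ - 3*π) (θ - 3*π + 2*π) ∪ Ioc (θ - π) (θ - π + 2*π)) ∪ Ioc (θ + π) (θ + π + 2*π) := by
    intro s hs
    have h1 := hs.1
    have h2 := hs.2
    simp only [mem_union, mem_Ioc]
    by_cases h3 : s ≤ θ - π
    · left; left; constructor <;> linarith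
    · push Not at h3
      by_cases h4 : s ≤ θ + π
      · left; right; constructor <;> linarith
      · push Not at h4
        right; constructor <;> linarith
  refine (lintegral_mono_set hsub).trans ((lintegral_union_le _ _ _).trans ((add_le_add (lintegral_union_le _ _ _) le_rfl).trans (le_of_eq ?_)))
  rw [per_int' hH _ 0, per_int' hH _ 0, per_int' hH _ 0]
  ring

lemma wpt {p : ℝ} (hp0 : 0 < p) (hp1 : p < 1) {θ h s x : ℝ} (hh : h ∈ Ioc (0:ℝ) 1) (hs : s ∈ arcInterval θ (3*h)) (hx : x ∈ Ioc 0 (h/2)) :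
    x^p ≤ 144 * h^p * (1 - ‖moebius (((1 - h : ℝ):ℂ) * Complex.exp (Complex.I * θ)) (((1 - x : ℝ):ℂ) * Complex.exp (Complex.I * s))‖^2)^p := by
  have h0 := hh.1
  have x0 := hx.1
  have h1 := hh.2
  have hx2 := hx.2
  set a := ((1 - h : ℝ):ℂ) * Complex.exp (Complex.I * θ) with ha
  set z := ((1 - x : ℝ):ℂ) * Complex.exp (Complex.I * s) with hz
  have na : ‖a‖ = 1 - h := by
    rw [ha, norm_mul, norm_ee, mul_one, Complex.norm_real, Real.norm_eq_abs, abs_of_nonneg (by linarith)]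
  have nz : ‖z‖ = 1 - x := by
    rw [hz, norm_mul, norm_ee, mul_one, Complex.norm_real, Real.norm_eq_abs, abs_of_nonneg (by linarith)]
  have hden : ‖1 - (starRingEnd ℂ) a * z‖ ≤ 12*h := by
    have e1 : (starRingEnd ℂ) (Complex.exp (Complex.I * θ)) * Complex.exp (Complex.I * θ) = 1 := by
      rw [conj_mul_eq, norm_ee]; simp
    have e2 : 1 - (starRingEnd ℂ) a * z = (starRingEnd ℂ) (Complex.exp (Complex.I * θ)) * ((Complex.exp (Complex.I * θ) - Complex.exp (Complex.I * s)) + ((1 - (1-h)*(1-x) : ℝ):ℂ) * Complex.exp (Complex.I * s)) := by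
      rw [← e1, ha, hz, map_mul, Complex.conj_ofReal]; push_cast; ring
    rw [e2, norm_mul, RCLike.norm_conj, norm_ee, one_mul]
    refine (norm_add_le _ _).trans ?_
    have h3 := ee_sub_le θ s
    have h4 := mem_arc.1 hs
    rw [abs_sub_comm] at h4
    have h5 : ‖((1 - (1-h)*(1-x) : ℝ):ℂ) * Complex.exp (Complex.I * s)‖ ≤ h + x := by
      rw [norm_mul, norm_ee, mul_one, Complex.norm_real, Real.norm_eq_abs, abs_of_nonneg (by nlinarith)]
      nlinarith
    have := Real.pi_lt_d2
    nlinarith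
  have hne : 0 < ‖1 - (starRingEnd ℂ) a * z‖ := norm_pos_iff.2 (mob_den_ne (by rw [na]; linarith) (by rw [nz]; linarith))
  have hW : x ≤ (144*h) * (1 - ‖moebius a z‖^2) := by
    rw [mob_one_sub (by rw [na]; linarith) (by rw [nz]; linarith), na, nz, mul_div_assoc', le_div_iff₀ (by positivity)]
    have q1 : ‖1 - (starRingEnd ℂ) a * z‖^2 ≤ (12*h)^2 := pow_le_pow_left₀ hne.le hden 2
    have q2 : h ≤ 1 - (1-h)^2 := by nlinarith
    have q3 : x ≤ 1 - (1-x)^2 := by nlinarith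
    have q4 : h * x ≤ (1 - (1-h)^2) * (1 - (1-x)^2) := mul_le_mul q2 q3 x0.le (by linarith)
    calc x * ‖1 - (starRingEnd ℂ) a * z‖^2 ≤ x * (12*h)^2 := by gcongr
      _ = 144*h*(h*x) := by ring
      _ ≤ _ := by gcongr
  have hpos : 0 ≤ 1 - ‖moebius a z‖^2 := by
    by_contra hc
    push Not at hc
    nlinarith
  calc x^p ≤ ((144*h) * (1 - ‖moebius a z‖^2))^p := Real.rpow_le_rpow x0.le hW hp0.le
    _ = 144^p * h^p * (1 - ‖moebius a z‖^2)^p := by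
        rw [Real.mul_rpow (by positivity) hpos, Real.mul_rpow (by norm_num) h0.le]
    _ ≤ _ := by
        have : (144:ℝ)^p ≤ 144 := by
          have := Real.rpow_le_rpow_of_exponent_le (x := 144) (by norm_num) hp1.le
          simpa using this
        have := Real.rpow_nonneg hpos p
        gcongr

lemma dirB2 {p : ℝ} (hp0 : 0 < p) (hp1 : p < 1) (f : ℂ → ℂ) {θ h : ℝ} (hh : h ∈ Ioc (0:ℝ) 1) :
    PP p f (arcInterval θ (3*h)) (h/2) ≤ ENNReal.ofReal (864*h^p) * qpIntegral p f (((1 - h : ℝ):ℂ) * Complex.exp (Complex.I * θ)) := by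
  have h0 := hh.1
  have am : ∀ θ k, MeasurableSet (arcInterval θ k) := fun θ k => measurableSet_Ioo
  set a := ((1 - h : ℝ):ℂ) * Complex.exp (Complex.I * θ) with ha
  set G : ℂ → ℝ≥0∞ := unitDisk.indicator (fun z => ‖deriv f z‖ₑ^2 * ENNReal.ofReal ((1 - ‖moebius a z‖ ^ 2) ^ p)) with hG
  have hGm : Measurable G := ((measurable_deriv f).enorm.pow_const 2 |>.mul (mobw_meas p a)).indicator disk_open.measurableSet
  have hq : qpIntegral p f a = ∫⁻ z, G z := by
    rw [hG, lintegral_indicator disk_open.measurableSet, qpIntegral]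
    refine lintegral_congr fun z => ?_
    rw [ENNReal.ofReal_mul (by positivity), ofReal_sq_norm]
  set H : ℝ → ℝ≥0∞ := fun s => ∫⁻ x in Ioc (0:ℝ) (1/2), G (((1 - x : ℝ):ℂ) * Complex.exp (Complex.I * s)) with hH
  have hHper : Function.Periodic H (2*π) := by
    intro s
    have := exp_per s
    simp only at this
    simp only [hH]
    rw [this]
  have hpt : ∀ s ∈ arcInterval θ (3*h), ∫⁻ x in Ioc 0 (h/2), ENNReal.ofReal (x^p) * gg f x s^2 ≤ ENNReal.ofReal (144*h^p) * H s := by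
    intro s hs
    have : ∫⁻ x in Ioc 0 (h/2), ENNReal.ofReal (x^p) * gg f x s^2 ≤ ∫⁻ x in Ioc 0 (h/2), ENNReal.ofReal (144*h^p) * G (((1 - x : ℝ):ℂ) * Complex.exp (Complex.I * s)) := by
      refine setLIntegral_mono' measurableSet_Ioc fun x hx => ?_
      have hmem : ((1 - x : ℝ):ℂ) * Complex.exp (Complex.I * s) ∈ unitDisk := ray_mem hx.1 (by linarith [hx.2, hh.2])
      rw [hG, indicator_of_mem hmem, gg, mul_left_comm, ← ENNReal.ofReal_mul (by positivity), mul_comm]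
      exact mul_le_mul_right (ENNReal.ofReal_le_ofReal (wpt hp0 hp1 hh hs hx)) _
    refine this.trans ?_
    rw [lintegral_const_mul' _ _ ENNReal.ofReal_ne_top]
    exact mul_le_mul_right (lintegral_mono_set (Ioc_subset_Ioc_right (by linarith [hh.2]))) _
  refine (setLIntegral_mono' (am _ _) hpt).trans ?_
  rw [lintegral_const_mul' _ _ ENNReal.ofReal_ne_top]
  have h6 : ∫⁻ s in arcInterval θ (3*h), H s ≤ 3 * (2 * ∫⁻ z, G z) :=
    (lintegral_mono_set (arc_mono (by linarith [hh.2]))).trans ((three_per hHper θ).trans (mul_le_mul_right (polar_bd hGm) _))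
  refine (mul_le_mul_right h6 _).trans (le_of_eq ?_)
  have e : ENNReal.ofReal (864*h^p) = ENNReal.ofReal (144*h^p) * (3*2) := by
    rw [show 864*h^p = 144*h^p*6 by ring, ENNReal.ofReal_mul (by positivity), ENNReal.ofReal_ofNat]; norm_num
  rw [hq, e]; ring

lemma dirB {p : ℝ} (hp0 : 0 < p) (hp1 : p < 1) : ∃ C : ℝ, 0 < C ∧ ∀ (f : ℂ → ℂ) (fb : ℝ → ℂ), DifferentiableOn ℂ f unitDisk →
    Function.Periodic fb (2*π) → RadialLimit f fb → ∀ θ : ℝ, ∀ h ∈ Ioc (0:ℝ) 1, ∃ a ∈ unitDisk,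
    qpTDouble p fb θ h ≤ ENNReal.ofReal (C * h^p) * qpIntegral p f a := by
  obtain ⟨C, hC, hB⟩ := dirB1 hp0 hp1
  refine ⟨C * 864, by positivity, fun f fb hf hper hR θ h hh => ⟨_, ray_mem (s := θ) hh.1 hh.2, ?_⟩⟩
  exact (hB f fb hf hper hR θ h hh).trans ((mul_le_mul_right (dirB2 hp0 hp1 f hh (θ := θ)) _).trans (le_of_eq (by
    rw [← mul_assoc, ← ENNReal.ofReal_mul hC.le, mul_assoc C])))

/-- For `0 < p < 1` and `f ∈ H²` with boundary-value function `fb` on the circle: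
`f ∈ Q_p` if and only if the `Q_p(𝕋)` norm of `fb` is finite; moreover the `Q_p` and
`Q_p(𝕋)` norms (squared) are comparable, with constants depending only on `p`. -/
theorem memQp_iff_memQpT_boundary (p : ℝ) (hp0 : 0 < p) (hp1 : p < 1) :
    ∃ c₁ c₂ : ℝ, 0 < c₁ ∧ 0 < c₂ ∧
      ∀ (f : ℂ → ℂ) (fb : ℝ → ℂ), DifferentiableOn ℂ f unitDisk → h2Bounded f →
        Measurable fb → Function.Periodic fb (2 * Real.pi) → RadialLimit f fb →
        ((MemQp p f ↔ MemQpT p fb) ∧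
          ENNReal.ofReal c₁ * qpNormSq p f fb ≤ qpTNormSq p fb ∧
          qpTNormSq p fb ≤ ENNReal.ofReal c₂ * qpNormSq p f fb) := by
  obtain ⟨CA, hCA, hA⟩ := dirA hp0 hp1
  obtain ⟨CB, hCB, hB⟩ := dirB hp0 hp1
  refine ⟨(1 + CA)⁻¹, 1 + CB, by positivity, by positivity, fun f fb hf h2 hm hper hR => ⟨⟨?_, ?_⟩, ?_, ?_⟩⟩
  · rintro ⟨-, -, C, hC⟩
    refine ⟨hper, hm, l2_fb hf h2 hR, CB * max C 0, fun θ h hh => ?_⟩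
    obtain ⟨a, ha, hab⟩ := hB f fb hf hper hR θ h hh
    refine hab.trans ((mul_le_mul_right (hC a ha) _).trans ?_)
    have hhp : 0 ≤ h ^ p := Real.rpow_nonneg hh.1.le p
    rw [← ENNReal.ofReal_mul (by positivity)]
    refine ENNReal.ofReal_le_ofReal ?_
    calc CB * h ^ p * C ≤ CB * h ^ p * max C 0 := by gcongr; exact le_max_left _ _
      _ = _ := by ring
  · rintro ⟨-, -, -, C, hC⟩
    refine ⟨hf, h2, CA * max C 0, fun a ha => ?_⟩
    refine hA f fb hf h2 hm hper hR (max C 0) (le_max_right _ _) (fun θ h hh => ?_) a ha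
    refine (hC θ h hh).trans (ENNReal.ofReal_le_ofReal ?_)
    have hhp : 0 ≤ h ^ p := Real.rpow_nonneg hh.1.le p
    gcongr
    exact le_max_left _ _
  · unfold qpNormSq qpTNormSq
    set S : ℝ≥0∞ := ⨆ (θ : ℝ) (h : ℝ) (_ : h ∈ Set.Ioc (0 : ℝ) 1),
      qpTDouble p fb θ h / ENNReal.ofReal (h ^ p) with hS
    by_cases hST : S = ⊤
    · rw [hST]; simp
    have hsup : (⨆ a ∈ unitDisk, qpIntegral p f a) ≤ ENNReal.ofReal CA * S := by
      refine iSup₂_le fun a ha => ?_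
      have := hA f fb hf h2 hm hper hR S.toReal ENNReal.toReal_nonneg (fun θ h hh => ?_) a ha
      · rwa [ENNReal.ofReal_mul hCA.le, ENNReal.ofReal_toReal hST] at this
      · have hhp : 0 < h ^ p := Real.rpow_pos_of_pos hh.1 p
        have h3 : qpTDouble p fb θ h / ENNReal.ofReal (h ^ p) ≤ S :=
          le_iSup_of_le θ (le_iSup_of_le h (le_iSup_of_le hh le_rfl))
        rw [ENNReal.div_le_iff (ENNReal.ofReal_pos.2 hhp).ne' ENNReal.ofReal_ne_top] at h3
        rwa [ENNReal.ofReal_mul ENNReal.toReal_nonneg, ENNReal.ofReal_toReal hST]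
    have h4 : l2Circle fb + (⨆ a ∈ unitDisk, qpIntegral p f a)
        ≤ ENNReal.ofReal (1 + CA) * (l2Circle fb + S) := by
      rw [ENNReal.ofReal_add zero_le_one hCA.le, ENNReal.ofReal_one, mul_add]
      refine add_le_add (le_mul_of_one_le_left' le_self_add) (hsup.trans ?_)
      exact mul_le_mul_left le_add_self _
    refine (mul_le_mul_right h4 _).trans (le_of_eq ?_)
    rw [← mul_assoc, ← ENNReal.ofReal_mul (by positivity), inv_mul_cancel₀ (by positivity),
      ENNReal.ofReal_one, one_mul]
  · unfold qpNormSq qpTNormSq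
    rw [ENNReal.ofReal_add zero_le_one hCB.le, ENNReal.ofReal_one, mul_add]
    refine add_le_add (le_mul_of_one_le_left' le_self_add) ?_
    refine iSup_le fun θ => iSup₂_le fun h hh => ?_
    obtain ⟨a, ha, hab⟩ := hB f fb hf hper hR θ h hh
    have hhp : 0 < h ^ p := Real.rpow_pos_of_pos hh.1 p
    rw [ENNReal.div_le_iff (ENNReal.ofReal_pos.2 hhp).ne' ENNReal.ofReal_ne_top]
    refine hab.trans ?_
    rw [ENNReal.ofReal_mul hCB.le, mul_right_comm]
    refine mul_le_mul_left ?_ _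
    refine (mul_le_mul_left (le_add_self (b := (1:ℝ≥0∞))) _).trans (mul_le_mul_right ?_ _)
    exact le_iSup₂_of_le a ha le_rfl

end
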